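/- Let k be a field of characteristic zero and X a set with eight elements. Then the Jacobson radical J(𝓡_X) of the monoid algebra 𝓡_X = k𝓒(X,X) of the monoid of relations on X has dimension 18446568932288588616 as a k-vector space. -/

import Mathlib

/-- Composition of correspondences: `rcomp R S = {(z,x) | ∃ y, (z,y) ∈ R ∧ (y,x) ∈ S}`. -/
def rcomp {α β γ : Type*} (R : Set (γ × β)) (S : Set (β × α)) : Set (γ × α) :=
  {p | ∃ y, (p.1, y) ∈ R ∧ (y, p.2) ∈ S}

/-- The diagonal relation. -/
def diag (X : Type*) : Set (X × X) := {p | p.1 = p.2}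

theorem rcomp_assoc {α β γ δ : Type*} (R : Set (δ × γ)) (S : Set (γ × β)) (T : Set (β × α)) :
    rcomp (rcomp R S) T = rcomp R (rcomp S T) := by
  ext ⟨z, x⟩
  constructor
  · rintro ⟨y, ⟨w, hw1, hw2⟩, hy⟩
    exact ⟨w, hw1, y, hw2, hy⟩
  · rintro ⟨w, hw, y, hy1, hy2⟩
    exact ⟨y, ⟨w, hw, hy1⟩, hy2⟩

theorem diag_rcomp {α β : Type*} (R : Set (β × α)) : rcomp (diag β) R = R := by
  ext ⟨z, x⟩
  simp [rcomp, diag]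

theorem rcomp_diag {α β : Type*} (R : Set (β × α)) : rcomp R (diag α) = R := by
  ext ⟨z, x⟩
  simp [rcomp, diag]

/-- The monoid `𝓒(X,X)` of all relations on `X` under composition of correspondences,
with identity the diagonal `Δ_X`. -/
instance relMonoid (X : Type*) : Monoid (Set (X × X)) where
  mul := rcomp
  one := diag X
  mul_assoc := rcomp_assoc
  one_mul := diag_rcomp
  mul_one := rcomp_diag

section MonoidRadical

open MonoidAlgebra

variable {k M : Type*} [Field k]

/-- The linear functional on the monoid algebra extending a function on the monoid. -/
noncomputable def evalFun (f : M → k) : MonoidAlgebra k M →ₗ[k] k where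
  toFun a := a.coeff.sum fun m c => c * f m
  map_add' a b := by
    rw [coeff_add, Finsupp.sum_add_index'] <;> intros <;> ring
  map_smul' c a := by
    rw [coeff_smul, Finsupp.sum_smul_index' (by simp)]
    simp [Finsupp.sum, Finset.mul_sum, mul_assoc]

@[simp] theorem evalFun_single (f : M → k) (m : M) (c : k) :
    evalFun f (single m c) = c * f m := by
  simp [evalFun]

variable [Monoid M]

open Classical in
/-- The indicator of `{q | r * q * l = e}`. -/
noncomputable def sandwich (k : Type*) [Field k] (e r l : M) (q : M) : k :=
  if r * q * l = e then 1 else 0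

theorem coeff_sandwich (e r l : M) (a : MonoidAlgebra k M) :
    (single r 1 * a * single l 1 : MonoidAlgebra k M).coeff e = evalFun (sandwich k e r l) a := by
  classical
  induction a using MonoidAlgebra.induction_linear with
  | zero => simp
  | add x y hx hy => rw [mul_add, add_mul, coeff_add, map_add, ← hx, ← hy]; rfl
  | single m c =>
    simp [single_mul_single, Finsupp.single_apply, sandwich]

theorem exists_mul_not_mem_of_not_mem (P : Ideal (MonoidAlgebra k M)) (a s : MonoidAlgebra k M)
    (h : a * s ∉ P) : ∃ m, a.coeff m ≠ 0 ∧ (single m 1 * s : MonoidAlgebra k M) ∉ P := by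
  by_contra! H
  refine h ?_
  rw [← sum_coeff_single a, Finsupp.sum, Finset.sum_mul]
  refine Ideal.sum_mem _ fun m hm => ?_
  have : (single m (a.coeff m) : MonoidAlgebra k M) = single 1 (a.coeff m) * single m 1 := by
    simp [single_mul_single]
  rw [this, mul_assoc]
  exact P.mul_mem_left _ (H m (by simpa using hm))

theorem exists_pow_isIdempotentElem [Finite M] (x : M) :
    ∃ n, n ≠ 0 ∧ IsIdempotentElem (x ^ n) := by
  obtain ⟨a, b, hab, h⟩ : ∃ a b, a < b ∧ x ^ a = x ^ b := by
    obtain ⟨a, b, hne, h⟩ := Finite.exists_ne_map_eq_of_infinite (fun n : ℕ => x ^ n)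
    rcases lt_or_gt_of_ne hne with h1 | h1
    · exact ⟨a, b, h1, h⟩
    · exact ⟨b, a, h1, h.symm⟩
  have key : ∀ j i, a ≤ i → x ^ (i + j * (b - a)) = x ^ i := by
    intro j
    induction j with
    | zero => simp
    | succ j ih =>
      intro i hi
      have h2 : i + (j + 1) * (b - a) = b + (i - a + j * (b - a)) := by
        rw [add_mul]; omega
      rw [h2, pow_add, ← h, ← pow_add, ← ih i hi]
      congr 1
      omega
  refine ⟨(a + 1) * (b - a), by simp; omega, ?_⟩
  rw [IsIdempotentElem, ← pow_add]
  exact key _ _ (by nlinarith [Nat.sub_pos_of_lt hab])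

/-- The local monoid `e M e` of an idempotent `e`. -/
abbrev localMonoid (e : M) (he : e * e = e) : Monoid {x : M // e * x = x ∧ x * e = x} where
  mul x y := ⟨x.1 * y.1, by rw [← mul_assoc, x.2.1], by rw [mul_assoc, y.2.2]⟩
  mul_assoc _ _ _ := Subtype.ext (mul_assoc _ _ _)
  one := ⟨e, he, he⟩
  one_mul x := Subtype.ext x.2.1
  mul_one x := Subtype.ext x.2.2

/-- In a finite monoid, a left inverse in a local monoid `e M e` is a right inverse. -/
theorem local_mul_eq_comm [Finite M] {e x y : M} (he : e * e = e) (hx : e * x = x)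
    (hx' : x * e = x) (hy : e * y = y) (hy' : y * e = y) (h : x * y = e) : y * x = e := by
  let _ := localMonoid e he
  let x' : {x : M // e * x = x ∧ x * e = x} := ⟨x, hx, hx'⟩
  let y' : {x : M // e * x = x ∧ x * e = x} := ⟨y, hy, hy'⟩
  have : x' * y' = 1 := Subtype.ext h
  exact congrArg Subtype.val (mul_eq_one_symm this)

/-- Elements killed by all the functionals `sandwich e r l` lie in every maximal left ideal. -/
theorem mem_of_sandwich_eq_zero [Finite M] (P : Ideal (MonoidAlgebra k M)) (hP : P.IsMaximal)
    (a : MonoidAlgebra k M)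
    (ha : ∀ e r l : M, e * e = e → e * r = r → l * e = l → evalFun (sandwich k e r l) a = 0) :
    a ∈ P := by
  classical
  by_contra haP
  let I : M → Set M := fun q => {x | ∃ u v, x = u * q * v}
  let act : M → Prop := fun q => ∃ s, (single q 1 * s : MonoidAlgebra k M) ∉ P
  have hI : ∀ q u v, I (u * q * v) ⊆ I q := by
    rintro q u v _ ⟨u', v', rfl⟩
    exact ⟨u' * u, v * v', by simp only [mul_assoc]⟩
  have hinv : ∀ (s c t : MonoidAlgebra k M), s ∉ P → c * t ∉ P →
      ∃ m : M, c * (single m 1 * s) ∉ P := by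
    intro s c t hs hct
    obtain ⟨b, i, hi, hb⟩ := hP.exists_inv hs
    have h1 : c * (t * b) * s ∉ P := by
      intro h
      apply hct
      have : c * t = c * (t * b) * s + (c * t) * i := by
        conv_lhs => rw [← mul_one (c * t), ← hb, mul_add]
        simp only [mul_assoc]
      rw [this]
      exact P.add_mem h (P.mul_mem_left _ hi)
    by_contra! H
    apply h1
    rw [← sum_coeff_single (t * b), Finsupp.sum, Finset.mul_sum, Finset.sum_mul]
    refine Ideal.sum_mem _ fun m _ => ?_
    have h2 : (single m ((t * b).coeff m) : MonoidAlgebra k M)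
        = algebraMap k _ ((t * b).coeff m) * single m 1 := by
      simp [single_mul_single]
    rw [h2, ← mul_assoc, ← Algebra.commutes, mul_assoc, mul_assoc]
    exact P.mul_mem_left _ (H m)
  obtain ⟨q, ⟨s, hs⟩, hmin⟩ : ∃ q, act q ∧ ∀ q', act q' → (I q).ncard ≤ (I q').ncard := by
    have hne : {q | act q}.Nonempty :=
      ⟨1, 1, by rw [← one_def, one_mul]; exact fun h => hP.ne_top ((Ideal.eq_top_iff_one _).2 h)⟩
    exact Set.exists_min_image {q | act q} (fun q => (I q).ncard) (Set.toFinite _) hne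
  have hmin' : ∀ u v, act (u * q * v) → I (u * q * v) = I q := fun u v h =>
    Set.eq_of_subset_of_ncard_le (hI q u v) (hmin _ h) (Set.toFinite _)
  have self_mem : ∀ q, q ∈ I q := fun q => ⟨1, 1, by simp⟩
  have mul_single : ∀ x y : M, (single (x * y) 1 : MonoidAlgebra k M) = single x 1 * single y 1 :=
    fun x y => by rw [single_mul_single, one_mul]
  obtain ⟨x, hx⟩ := hinv _ (single q 1) s hs hs
  have hqbq : I (1 * q * (x * q)) = I q := hmin' _ _ ⟨s, by
    rwa [one_mul, mul_single, mul_single, mul_assoc, mul_assoc]⟩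
  obtain ⟨u, v, huv⟩ : q ∈ I (1 * q * (x * q)) := hqbq ▸ self_mem q
  have hq1 : q = (u * q * x) * q * v := by
    conv_lhs => rw [huv]
    simp only [mul_assoc, one_mul]
  have hqn : ∀ n, q = (u * q * x) ^ n * q * v ^ n := by
    intro n
    induction n with
    | zero => simp
    | succ n ih =>
      calc q = (u * q * x) ^ n * q * v ^ n := ih
        _ = (u * q * x) ^ n * ((u * q * x) * q * v) * v ^ n := by rw [← hq1]
        _ = _ := by rw [pow_succ (u * q * x), pow_succ' v]; simp only [mul_assoc]
  obtain ⟨n, hn, he⟩ := exists_pow_isIdempotentElem (u * q * x)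
  obtain ⟨n, rfl⟩ := Nat.exists_eq_succ_of_ne_zero hn
  set e := (u * q * x) ^ (n + 1) with he_def
  have heq : e = u * q * (x * (u * q * x) ^ n) := by
    rw [he_def, pow_succ']; simp only [mul_assoc]
  have he' : e * e = e := he
  obtain ⟨t, ht⟩ : act e := ⟨single (q * v ^ (n + 1)) 1 * s, by
    rw [← mul_assoc, ← mul_single, ← mul_assoc]
    rwa [he_def, ← hqn (n + 1)]⟩
  have hIe : I e = I q := by rw [heq]; exact hmin' _ _ (heq ▸ ⟨t, ht⟩)
  obtain ⟨b, hb⟩ := hinv _ a 1 ht (by rwa [mul_one])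
  obtain ⟨c, hc⟩ := hinv _ (single e 1) t hb ht
  have hprod : (single e 1 * (single c 1 * (a * (single b 1 * (single e 1 * t)))) :
      MonoidAlgebra k M) = single (e * c) 1 * a * single (b * e) 1 * t := by
    rw [mul_single, mul_single]; simp only [mul_assoc]
  rw [hprod] at hc
  obtain ⟨z, hz0, hz⟩ := exists_mul_not_mem_of_not_mem P _ _ hc
  rw [coeff_sandwich] at hz0
  obtain ⟨w, hw⟩ : ∃ w, e * c * w * (b * e) = z := by
    by_contra! H
    apply hz0
    have : sandwich k z (e * c) (b * e) = 0 := by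
      funext w; simp [sandwich, H w]
    rw [this]
    simp [evalFun]
  have hez : e * z = z := by rw [← hw]; simp only [← mul_assoc, he']
  have hze : z * e = z := by rw [← hw]; simp only [mul_assoc, he']
  have hIz : I z = I q := by
    have : z = (z * u) * q * (x * (u * q * x) ^ n) := by
      conv_lhs => rw [← hze, heq]
      simp only [mul_assoc]
    rw [this]
    exact hmin' _ _ (this ▸ ⟨t, hz⟩)
  obtain ⟨u', v', huv'⟩ : e ∈ I z := by rw [hIz, ← hIe]; exact self_mem e
  set u1 := e * u' * e with hu1
  set v1 := e * v' * e with hv1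
  have h1 : u1 * (z * v1) = e := by
    calc u1 * (z * v1) = e * (u' * ((e * z * e) * v')) * e := by
          rw [hu1, hv1]; simp only [mul_assoc]
      _ = e := by rw [hez, hze, ← mul_assoc u', ← huv', he', he']
  have eu1 : e * u1 = u1 := by simp only [hu1, ← mul_assoc, he']
  have ue1 : u1 * e = u1 := by simp only [hu1, mul_assoc, he']
  have ev1 : e * v1 = v1 := by simp only [hv1, ← mul_assoc, he']
  have ve1 : v1 * e = v1 := by simp only [hv1, mul_assoc, he']
  have h2 : z * (v1 * u1) = e := by
    rw [← mul_assoc]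
    exact local_mul_eq_comm he' eu1 ue1 (by rw [← mul_assoc, hez]) (by rw [mul_assoc, ve1]) h1
  have h3 : (v1 * u1) * z = e :=
    local_mul_eq_comm he' hez hze (by rw [← mul_assoc, ev1]) (by rw [mul_assoc, ue1]) h2
  apply hz0
  rw [← ha e (v1 * u1 * (e * c)) (b * e) he' (by simp only [← mul_assoc, ev1])
    (by rw [mul_assoc, he'])]
  congr 2
  funext w
  have : e * c * w * (b * e) = z ↔ v1 * u1 * (e * c) * w * (b * e) = e := by
    constructor
    · intro h
      calc v1 * u1 * (e * c) * w * (b * e) = v1 * u1 * (e * c * w * (b * e)) := by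
            simp only [mul_assoc]
        _ = e := by rw [h, h3]
    · intro h
      have h4 : z * (v1 * u1 * (e * c) * w * (b * e)) = z * e := by rw [h]
      rw [hze] at h4
      rw [← h4]
      have h5 : z * (v1 * u1 * (e * c) * w * (b * e))
        = (z * (v1 * u1)) * (e * c * w * (b * e)) := by simp only [mul_assoc]
      rw [h5, h2]
      simp only [← mul_assoc, he']
  simp only [sandwich, this]

/-- In characteristic zero, a nilpotent element of a group algebra has zero coefficient at the
identity. -/
theorem coeff_one_eq_zero_of_isNilpotent {G : Type*} [Group G] [Finite G] [CharZero k]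
    (y : MonoidAlgebra k G) (hy : IsNilpotent y) : y.coeff 1 = 0 := by
  classical
  cases nonempty_fintype G
  let b : Module.Basis G k (MonoidAlgebra k G) := Module.Basis.ofRepr (coeffLinearEquiv k)
  have h1 : IsNilpotent (LinearMap.mulLeft k y) := (LinearMap.isNilpotent_mulLeft_iff k y).2 hy
  have h2 := (LinearMap.isNilpotent_trace_of_isNilpotent h1).eq_zero
  rw [LinearMap.trace_eq_matrix_trace k b, Matrix.trace] at h2
  have h3 : ∀ g : G, (LinearMap.toMatrix b b (LinearMap.mulLeft k y)).diag g = y.coeff 1 := by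
    intro g
    rw [Matrix.diag_apply, LinearMap.toMatrix_apply]
    have : b g = single g 1 := by
      simp [b]
    rw [this]
    simp [b]
  simp only [h3] at h2
  simpa using h2

/-- A nilpotent element of the algebra of a finite monoid has zero coefficient at the identity. -/
theorem coeff_one_eq_zero_of_isNilpotent' [Finite M] [CharZero k]
    (y : MonoidAlgebra k M) (hy : IsNilpotent y) : y.coeff 1 = 0 := by
  classical
  let f : M →* MonoidAlgebra k Mˣ :=
    { toFun := fun m => if h : IsUnit m then single h.unit 1 else 0
      map_one' := by simp [one_def]
      map_mul' := fun a b => by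
        by_cases ha : IsUnit a
        · by_cases hb : IsUnit b
          · rw [dif_pos (ha.mul hb), dif_pos ha, dif_pos hb, single_mul_single, mul_one]
            congr 1
            ext; simp
          · rw [dif_neg hb, mul_zero, dif_neg (fun h => hb (isUnit_of_mul_isUnit_right h))]
        · rw [dif_neg ha, zero_mul, dif_neg (fun h => ha (isUnit_of_mul_isUnit_left h))] }
  let F := MonoidAlgebra.lift k (MonoidAlgebra k Mˣ) M f
  have h := coeff_one_eq_zero_of_isNilpotent (F y) (hy.map F)
  have h2 : ∀ y, (F y).coeff 1 = y.coeff 1 := by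
    intro y
    induction y using MonoidAlgebra.induction_linear with
    | zero => simp
    | add x y hx hy => rw [map_add, coeff_add, coeff_add, Finsupp.add_apply, hx, hy]; rfl
    | single m c =>
      by_cases hm : IsUnit m
      · have : hm.unit = 1 ↔ m = 1 := by rw [← Units.val_inj]; simp
        simp [F, f, hm, Finsupp.single_apply, this]
      · have : m ≠ 1 := fun h => hm (h ▸ isUnit_one)
        simp [F, f, hm, this]
  rw [← h2, h]

theorem evalFun_sandwich_eq_zero [Finite M] [CharZero k] {a : MonoidAlgebra k M}
    (ha : a ∈ Ideal.jacobson (⊥ : Ideal (MonoidAlgebra k M))) {e r l : M} (he : e * e = e)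
    (hr : e * r = r) (hl : l * e = l) : evalFun (sandwich k e r l) a = 0 := by
  rw [← coeff_sandwich]
  have hart : IsArtinianRing (MonoidAlgebra k M) := IsArtinianRing.of_finite k _
  let _ := localMonoid e he
  let ι : {x : M // e * x = x ∧ x * e = x} →ₙ* M := ⟨Subtype.val, fun _ _ => rfl⟩
  let g : M → {x : M // e * x = x ∧ x * e = x} := fun q =>
    ⟨r * q * l, by rw [← mul_assoc, ← mul_assoc, hr], by rw [mul_assoc, hl]⟩
  have hg : ∀ a, mapDomainNonUnitalRingHom k ι (mapDomain g a) =
      single r 1 * a * single l 1 := by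
    intro a
    induction a using MonoidAlgebra.induction_linear with
    | zero => simp
    | add x y hx hy => rw [mapDomain_add, map_add, hx, hy, mul_add, add_mul]
    | single m c => simp [single_mul_single, ι, g]
  have hinj : Function.Injective (mapDomainNonUnitalRingHom k ι) :=
    mapDomain_injective Subtype.val_injective
  have hJ : (single r 1 * a * single l 1 : MonoidAlgebra k M) ∈
      Ideal.jacobson (⊥ : Ideal (MonoidAlgebra k M)) :=
    Ideal.mul_mem_right _ _ (Ideal.mul_mem_left _ _ ha)
  have hnil : IsNilpotent (mapDomain g a) := by
    obtain ⟨n, hn⟩ := IsArtinianRing.isNilpotent_jacobson_bot (R := MonoidAlgebra k M)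
    have h1 := Ideal.pow_mem_pow hJ (n + 1)
    refine ⟨n + 1, hinj ?_⟩
    have h2 : ∀ n, mapDomainNonUnitalRingHom k ι (mapDomain g a ^ (n + 1)) =
        (mapDomainNonUnitalRingHom k ι (mapDomain g a)) ^ (n + 1) := by
      intro n
      induction n with
      | zero => simp
      | succ n ih => rw [pow_succ, map_mul, ih, ← pow_succ]
    rw [h2, hg, map_zero]
    have h3 := Ideal.pow_le_pow_right (I := Ideal.jacobson (⊥ : Ideal (MonoidAlgebra k M)))
      (Nat.le_succ n) h1
    rwa [hn] at h3
  rw [← coeff_one_eq_zero_of_isNilpotent' _ hnil, ← hg]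
  exact Finsupp.mapDomain_apply Subtype.val_injective _ (1 : {x : M // e * x = x ∧ x * e = x})

theorem mem_jacobson_bot_iff [Finite M] [CharZero k] (a : MonoidAlgebra k M) :
    a ∈ Ideal.jacobson (⊥ : Ideal (MonoidAlgebra k M)) ↔
      ∀ e r l : M, e * e = e → e * r = r → l * e = l → evalFun (sandwich k e r l) a = 0 := by
  refine ⟨fun ha e r l he hr hl => evalFun_sandwich_eq_zero ha he hr hl, fun ha => ?_⟩
  exact Ideal.mem_sInf.2 fun {P} hP => mem_of_sandwich_eq_zero P hP.2 a ha

/-- The dimension of the radical is the corank of the space of functions spanned by the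
`sandwich` indicators. -/
theorem finrank_jacobson_add_finrank_span [Finite M] [CharZero k] (F : Set (M → k))
    (hF : Submodule.span k F = Submodule.span k
      {f | ∃ e r l : M, e * e = e ∧ e * r = r ∧ l * e = l ∧ f = sandwich k e r l}) :
    Module.finrank k (Submodule.restrictScalars k
        (Ideal.jacobson (⊥ : Ideal (MonoidAlgebra k M)))) +
      Module.finrank k (Submodule.span k F) = Nat.card M := by
  cases nonempty_fintype M
  let E : (M → k) →ₗ[k] Module.Dual k (MonoidAlgebra k M) :=
    { toFun := evalFun
      map_add' := fun f g => by ext a; simp [evalFun, Finsupp.sum, mul_add, Finset.sum_add_distrib]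
      map_smul' := fun c f => by ext a; simp [evalFun, Finsupp.sum, mul_left_comm] }
  have hE : Function.Injective E := by
    intro f g h
    funext m
    have := LinearMap.congr_fun h (single m 1)
    simpa [E] using this
  have h1 : Submodule.restrictScalars k (Ideal.jacobson (⊥ : Ideal (MonoidAlgebra k M))) =
      ((Submodule.span k F).map E).dualCoannihilator := by
    rw [hF]
    ext a
    rw [Submodule.restrictScalars_mem, mem_jacobson_bot_iff, Submodule.mem_dualCoannihilator]
    constructor
    · intro h φ hφ
      obtain ⟨f, hf, rfl⟩ := hφ
      induction hf using Submodule.span_induction with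
      | mem f hf =>
        obtain ⟨e, r, l, he, hr, hl, rfl⟩ := hf
        exact h e r l he hr hl
      | zero => simp
      | add f g _ _ hf hg => rw [map_add, LinearMap.add_apply, hf, hg, add_zero]
      | smul c f _ hf => rw [map_smul, LinearMap.smul_apply, hf, smul_zero]
    · intro h e r l he hr hl
      exact h _ ⟨_, Submodule.subset_span ⟨e, r, l, he, hr, hl, rfl⟩, rfl⟩
  have h2 := Subspace.finrank_add_finrank_dualCoannihilator_eq ((Submodule.span k F).map E)
  rw [← (Submodule.equivMapOfInjective E hE _).finrank_eq] at h2
  rw [h1, add_comm, h2, (coeffLinearEquiv k).finrank_eq, Module.finrank_finsupp_self,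
    Nat.card_eq_fintype_card]

end MonoidRadical

local notation:70 R:70 " ⊚ " S:71 => rcomp R S

section OrderFunctions

variable {α β γ X : Type*}

/-- The relation `R` is a partial order. -/
structure IsOrd (R : Set (α × α)) : Prop where
  refl : ∀ i, (i, i) ∈ R
  trans : ∀ i j l, (i, j) ∈ R → (j, l) ∈ R → (i, l) ∈ R
  antisymm : ∀ i j, (i, j) ∈ R → (j, i) ∈ R → i = j

open Classical in
/-- The indicator of `{Q | r Q l = R}`. -/
noncomputable def orderFun (k : Type*) [Field k] (R : Set (α × α)) (r : Set (α × X))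
    (l : Set (X × α)) (Q : Set (X × X)) : k :=
  if r ⊚ Q ⊚ l = R then 1 else 0

theorem exists_self_mem_of_idempotent [Finite X] {e : Set (X × X)} (he : e ⊚ e = e) {x y : X}
    (hxy : (x, y) ∈ e) : ∃ z, (x, z) ∈ e ∧ (z, z) ∈ e ∧ (z, y) ∈ e := by
  have tr : ∀ {a b c}, (a, b) ∈ e → (b, c) ∈ e → (a, c) ∈ e := fun h1 h2 => by
    rw [← he]; exact ⟨_, h1, h2⟩
  by_contra! H
  let S := {z : X // (x, z) ∈ e ∧ (z, y) ∈ e}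
  let lt : S → S → Prop := fun a b => (a.1, b.1) ∈ e
  have : IsTrans S lt := ⟨fun a b c h1 h2 => tr h1 h2⟩
  have : Std.Irrefl lt := ⟨fun a h => H a.1 a.2.1 h a.2.2⟩
  have wf : WellFounded lt := Finite.wellFounded_of_trans_of_irrefl lt
  have hne : Nonempty S := by
    rw [← he] at hxy
    obtain ⟨z, h1, h2⟩ := hxy
    exact ⟨⟨z, h1, h2⟩⟩
  obtain ⟨m, -, hm⟩ := wf.has_min Set.univ ⟨hne.some, trivial⟩
  obtain ⟨w, h1, h2⟩ : (x, m.1) ∈ e ⊚ e := by rw [he]; exact m.2.1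
  exact hm ⟨w, h1, tr h2 m.2.2⟩ trivial h2

/-- An idempotent relation on a finite set is split by a partial order. -/
theorem exists_splitting [Finite X] {e : Set (X × X)} (he : e ⊚ e = e) :
    ∃ n ≤ Nat.card X, ∃ ι : Fin n → X, IsOrd {p : Fin n × Fin n | (ι p.1, ι p.2) ∈ e} ∧
      ∀ x y, (x, y) ∈ e → ∃ i, (x, ι i) ∈ e ∧ (ι i, y) ∈ e := by
  have tr : ∀ {a b c}, (a, b) ∈ e → (b, c) ∈ e → (a, c) ∈ e := fun h1 h2 => by
    rw [← he]; exact ⟨_, h1, h2⟩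
  let s : Setoid {x : X // (x, x) ∈ e} :=
    { r := fun a b => (a.1, b.1) ∈ e ∧ (b.1, a.1) ∈ e
      iseqv := ⟨fun a => ⟨a.2, a.2⟩, fun h => h.symm,
        fun h1 h2 => ⟨tr h1.1 h2.1, tr h2.2 h1.2⟩⟩ }
  let f := Finite.equivFin (Quotient s)
  let ι : Fin (Nat.card (Quotient s)) → X := fun i => (f.symm i).out.1
  have hι : ∀ i j, (ι i, ι j) ∈ e → (ι j, ι i) ∈ e → i = j := by
    intro i j h1 h2
    apply f.symm.injective
    rw [← Quotient.out_eq (f.symm i), ← Quotient.out_eq (f.symm j)]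
    exact Quotient.sound ⟨h1, h2⟩
  refine ⟨Nat.card (Quotient s), ?_, ι, ⟨fun i => (f.symm i).out.2, fun _ _ _ h1 h2 => tr h1 h2,
    hι⟩, ?_⟩
  · have : Function.Injective ι := fun i j h => by
      have hi : (ι i, ι i) ∈ e := (f.symm i).out.2
      exact hι i j (h ▸ hi) (h ▸ hi)
    simpa using Nat.card_le_card_of_injective ι this
  · intro x y hxy
    obtain ⟨z, h1, h2, h3⟩ := exists_self_mem_of_idempotent he hxy
    have h4 : (((⟦⟨z, h2⟩⟧ : Quotient s).out.1, z) ∈ e) ∧ (z, (⟦⟨z, h2⟩⟧ : Quotient s).out.1) ∈ e :=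
      Quotient.mk_out (s := s) ⟨z, h2⟩
    refine ⟨f ⟦⟨z, h2⟩⟧, ?_⟩
    simp only [ι, Equiv.symm_apply_apply]
    exact ⟨tr h1 h4.2, tr h4.1 h3⟩

/-- The functions `orderFun R r l` for partial orders `R` on at most `card X` points. -/
def orderFuns (k : Type*) [Field k] (X : Type*) : Set (Set (X × X) → k) :=
  {f | ∃ n ≤ Nat.card X, ∃ (R : Set (Fin n × Fin n)) (r : Set (Fin n × X)) (l : Set (X × Fin n)),
    IsOrd R ∧ R ⊚ r = r ∧ l ⊚ R = l ∧ f = orderFun k R r l}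

theorem span_orderFuns (k : Type*) [Field k] (X : Type*) [Finite X] :
    Submodule.span k (orderFuns k X) = Submodule.span k
      {f | ∃ e r l : Set (X × X), e * e = e ∧ e * r = r ∧ l * e = l ∧ f = sandwich k e r l} := by
  have hmul : ∀ a b : Set (X × X), a * b = a ⊚ b := fun _ _ => rfl
  simp only [hmul]
  apply le_antisymm
  · rw [Submodule.span_le]
    rintro _ ⟨n, -, R, r, l, hR, hr, hl, rfl⟩
    by_cases H : ∃ Q, r ⊚ Q ⊚ l = R
    · obtain ⟨Q₀, hQ₀⟩ := H
      have hrl : ∀ c : Set (Fin n × X), r ⊚ (Q₀ ⊚ (l ⊚ c)) = R ⊚ c := by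
        intro c
        rw [← hQ₀]; simp only [rcomp_assoc]
      have hrl' : ∀ c : Set (Fin n × Fin n), r ⊚ (Q₀ ⊚ (l ⊚ c)) = R ⊚ c := by
        intro c
        rw [← hQ₀]; simp only [rcomp_assoc]
      have hr' : ∀ c : Set (X × Fin n), R ⊚ (r ⊚ c) = r ⊚ c := by
        intro c
        rw [← rcomp_assoc, hr]
      refine Submodule.subset_span ⟨Q₀ ⊚ l ⊚ r, Q₀ ⊚ l ⊚ r, l ⊚ r, ?_, ?_, ?_, ?_⟩
      · simp only [rcomp_assoc, hrl, hr]
      · simp only [rcomp_assoc, hrl, hr]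
      · simp only [rcomp_assoc, hrl, hr]
      · funext Q
        simp only [orderFun, sandwich, hmul]
        congr 1
        rw [eq_iff_iff]
        constructor
        · intro h
          calc Q₀ ⊚ l ⊚ r ⊚ Q ⊚ (l ⊚ r) = Q₀ ⊚ l ⊚ (r ⊚ Q ⊚ l) ⊚ r := by
                simp only [rcomp_assoc]
            _ = _ := by rw [h]; simp only [rcomp_assoc, hr]
        · intro h
          have h1 : r ⊚ (Q₀ ⊚ l ⊚ r ⊚ Q ⊚ (l ⊚ r)) ⊚ Q₀ ⊚ l = r ⊚ (Q₀ ⊚ l ⊚ r) ⊚ Q₀ ⊚ l := by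
            rw [h]
          have hQ' : r ⊚ (Q₀ ⊚ l) = R := by rw [← rcomp_assoc, hQ₀]
          simp only [rcomp_assoc, hrl', hr', hQ', hl] at h1
          rw [rcomp_assoc, h1]
    · have : orderFun k R r l = 0 := by
        funext Q
        simp only [orderFun, Pi.zero_apply]
        rw [if_neg fun h => H ⟨Q, h⟩]
      rw [this]
      exact zero_mem _
  · rw [Submodule.span_le]
    rintro _ ⟨e, r, l, he, hr, hl, rfl⟩
    obtain ⟨n, hn, ι, hR, hι⟩ := exists_splitting he
    refine Submodule.subset_span ⟨n, hn, {p | (ι p.1, ι p.2) ∈ e}, {p | (ι p.1, p.2) ∈ r},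
      {p | (p.1, ι p.2) ∈ l}, hR, ?_, ?_, ?_⟩
    · ext ⟨i, x⟩
      constructor
      · rintro ⟨j, h1, h2⟩
        show (ι i, x) ∈ r
        rw [← hr]
        exact ⟨_, h1, h2⟩
      · intro h
        exact ⟨i, hR.refl i, h⟩
    · ext ⟨x, i⟩
      constructor
      · rintro ⟨j, h1, h2⟩
        show (x, ι i) ∈ l
        rw [← hl]
        exact ⟨_, h1, h2⟩
      · intro h
        exact ⟨i, h, hR.refl i⟩
    · funext Q
      simp only [orderFun, sandwich, hmul]
      congr 1
      rw [eq_iff_iff]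
      have hres : ({p : Fin n × X | (ι p.1, p.2) ∈ r} ⊚ Q ⊚ {p : X × Fin n | (p.1, ι p.2) ∈ l}) =
        {p | (ι p.1, ι p.2) ∈ r ⊚ Q ⊚ l} := rfl
      rw [hres]
      constructor
      · intro h
        rw [h]
      · intro h
        have h1 : ∀ i j, (ι i, ι j) ∈ r ⊚ Q ⊚ l ↔ (ι i, ι j) ∈ e := fun i j =>
          Set.ext_iff.1 h (i, j)
        have h2 : e ⊚ (r ⊚ Q ⊚ l) ⊚ e = r ⊚ Q ⊚ l := by
          simp only [rcomp_assoc, hl]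
          rw [← rcomp_assoc, hr]
        have h3 : ∀ T : Set (X × X), e ⊚ T ⊚ e =
            {p | ∃ i j, (p.1, ι i) ∈ e ∧ (ι i, ι j) ∈ e ⊚ T ⊚ e ∧ (ι j, p.2) ∈ e} := by
          intro T
          ext ⟨x, y⟩
          constructor
          · rintro ⟨b, ⟨a, h4, h5⟩, h6⟩
            obtain ⟨i, hi, hi'⟩ := hι _ _ h4
            obtain ⟨j, hj, hj'⟩ := hι _ _ h6
            exact ⟨i, j, hi, ⟨b, ⟨a, hi', h5⟩, hj⟩, hj'⟩
          · rintro ⟨i, j, hi, ⟨b, ⟨a, h4, h5⟩, h6⟩, hj⟩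
            refine ⟨b, ⟨a, ?_, h5⟩, ?_⟩
            · rw [← he]; exact ⟨_, hi, h4⟩
            · rw [← he]; exact ⟨_, h6, hj⟩
        have h4 : e ⊚ e ⊚ e = e := by rw [he, he]
        have h5 := h3 e
        rw [h4] at h5
        rw [← h2, h3, h2]
        simp only [h1]
        exact h5.symm

end OrderFunctions

section Words

variable {k α X : Type*} [Field k]

/-- The principal upper set of `e`. -/
def upSet (R : Set (α × α)) (e : α) : Set α := {i | (e, i) ∈ R}

/-- The principal lower set of `e`. -/
def downSet (R : Set (α × α)) (e : α) : Set α := {i | (i, e) ∈ R}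

/-- The set of upper bounds of `a`. -/
def ubSet (R : Set (α × α)) (a : Set α) : Set α := {j | ∀ i ∈ a, (i, j) ∈ R}

/-- The set `a` is a lower set. -/
def IsDown (R : Set (α × α)) (a : Set α) : Prop := ∀ i j, (i, j) ∈ R → j ∈ a → i ∈ a

/-- The set `a` is an upper set. -/
def IsUp (R : Set (α × α)) (a : Set α) : Prop := ∀ i j, (i, j) ∈ R → i ∈ a → j ∈ a

/-- The sets of upper bounds of the non-principal lower sets. -/
def ubSets (R : Set (α × α)) : Set (Set α) :=
  {u | ∃ a, IsDown R a ∧ (∀ e, a ≠ downSet R e) ∧ u = ubSet R a}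

/-- Remove the generator of a principal upper set; leave all other sets unchanged. -/
def strip (R : Set (α × α)) (u : Set α) : Set α := {i | i ∈ u ∧ u ≠ upSet R i}

/-- Iterate `strip` until it becomes stationary. -/
noncomputable def stripAll (R : Set (α × α)) : Set α → Set α := (strip R)^[Nat.card α]

/-- The stripped sets of upper bounds of the non-principal lower sets. -/
def strippedSets (R : Set (α × α)) : Set (Set α) := stripAll R '' ubSets R

/-- The subset of `α` encoded by a letter. -/
def letterSet (R : Set (α × α)) : α ⊕ Set α → Set α := Sum.elim (upSet R) id

open Classical in
/-- The indicator of the relations `l` whose rows lie below the letters of `φ`, and for which every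
point `e` is marked by some letter `e`. -/
noncomputable def wordFun (k : Type*) [Field k] (R : Set (α × α)) (φ : X → α ⊕ Set α)
    (l : Set (X × α)) : k :=
  if (∀ x i, (x, i) ∈ l → i ∈ letterSet R (φ x)) ∧ ∀ e, ∃ x, φ x = Sum.inl e ∧ (x, e) ∈ l
  then 1 else 0

open Classical in
/-- The indicator of `{l | r l = R}`. -/
noncomputable def leftFun (k : Type*) [Field k] (R : Set (α × α)) (r : Set (α × X))
    (l : Set (X × α)) : k :=
  if r ⊚ l = R then 1 else 0

/-- The span of the functions of the words with letters in `α ⊕ T`. -/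
def wordSpan (k : Type*) [Field k] (X : Type*) (R : Set (α × α)) (T : Set (Set α)) :
    Submodule k (Set (X × α) → k) :=
  Submodule.span k {f | ∃ φ : X → α ⊕ Set α, (∀ x u, φ x = Sum.inr u → u ∈ T) ∧
    f = wordFun k R φ}

theorem leftFun_eq_wordFun {R : Set (α × α)} (hR : IsOrd R) {r : Set (α × X)} (hr : R ⊚ r = r)
    (φ : X → α ⊕ Set α) (hl : ∀ x e, φ x = Sum.inl e → {i | (i, x) ∈ r} = downSet R e)
    (hr' : ∀ x u, φ x = Sum.inr u → u = ubSet R {i | (i, x) ∈ r} ∧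
      ∀ e, {i | (i, x) ∈ r} ≠ downSet R e) :
    leftFun k R r = wordFun k R φ := by
  have hval : ∀ x, letterSet R (φ x) = ubSet R {i | (i, x) ∈ r} := by
    intro x
    rcases hx : φ x with e | u
    · rw [hl x e hx]
      ext j
      exact ⟨fun h i hi => hR.trans _ _ _ hi h, fun h => h e (hR.refl e)⟩
    · exact (hr' x u hx).1
  funext l
  simp only [leftFun, wordFun]
  congr 1
  rw [eq_iff_iff]
  constructor
  · intro h
    have h1 : ∀ x i, (x, i) ∈ l → i ∈ letterSet R (φ x) := by
      intro x i hxi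
      rw [hval]
      intro j hj
      rw [← h]
      exact ⟨x, hj, hxi⟩
    refine ⟨h1, fun e => ?_⟩
    obtain ⟨x, h2, h3⟩ : (e, e) ∈ r ⊚ l := by rw [h]; exact hR.refl e
    refine ⟨x, ?_, h3⟩
    have h4 : {i | (i, x) ∈ r} = downSet R e := by
      ext i
      constructor
      · intro hi
        show (i, e) ∈ R
        rw [← h]
        exact ⟨x, hi, h3⟩
      · intro hi
        show (i, x) ∈ r
        rw [← hr]
        exact ⟨e, hi, h2⟩
    rcases hx : φ x with e' | u
    · congr 1
      have h5 : downSet R e' = downSet R e := by rw [← h4, hl x e' hx]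
      apply hR.antisymm
      · show e' ∈ downSet R e
        rw [← h5]; exact hR.refl e'
      · show e ∈ downSet R e'
        rw [h5]; exact hR.refl e
    · exact absurd h4 ((hr' x u hx).2 e)
  · rintro ⟨h1, h2⟩
    ext ⟨i, j⟩
    constructor
    · rintro ⟨x, h3, h4⟩
      have := h1 x j h4
      rw [hval] at this
      exact this i h3
    · intro hij
      obtain ⟨x, h3, h4⟩ := h2 j
      refine ⟨x, ?_, h4⟩
      have : i ∈ {i | (i, x) ∈ r} := by rw [hl x j h3]; exact hij
      exact this

theorem span_leftFun {R : Set (α × α)} (hR : IsOrd R) :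
    Submodule.span k {f | ∃ r : Set (α × X), R ⊚ r = r ∧ f = leftFun k R r} =
      wordSpan k X R (ubSets R) := by
  classical
  have hclosed : ∀ r : Set (α × X), R ⊚ r = r ↔ ∀ x, IsDown R {i | (i, x) ∈ r} := by
    intro r
    constructor
    · intro h x i j hij hj
      show (i, x) ∈ r
      rw [← h]
      exact ⟨j, hij, hj⟩
    · intro h
      ext ⟨i, x⟩
      exact ⟨fun ⟨j, h1, h2⟩ => h x i j h1 h2, fun h1 => ⟨i, hR.refl i, h1⟩⟩
  apply le_antisymm
  · rw [Submodule.span_le]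
    rintro _ ⟨r, hr, rfl⟩
    let φ : X → α ⊕ Set α := fun x =>
      if h : ∃ e, {i | (i, x) ∈ r} = downSet R e then Sum.inl h.choose
      else Sum.inr (ubSet R {i | (i, x) ∈ r})
    have hφl : ∀ x e, φ x = Sum.inl e → {i | (i, x) ∈ r} = downSet R e := by
      intro x e hx
      by_cases h : ∃ e, {i | (i, x) ∈ r} = downSet R e
      · simp only [φ, dif_pos h, Sum.inl.injEq] at hx
        rw [← hx]
        exact h.choose_spec
      · simp [φ, dif_neg h] at hx
    have hφr : ∀ x u, φ x = Sum.inr u → u = ubSet R {i | (i, x) ∈ r} ∧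
        ∀ e, {i | (i, x) ∈ r} ≠ downSet R e := by
      intro x u hx
      by_cases h : ∃ e, {i | (i, x) ∈ r} = downSet R e
      · simp [φ, dif_pos h] at hx
      · simp only [φ, dif_neg h, Sum.inr.injEq] at hx
        exact ⟨hx.symm, not_exists.1 h⟩
    refine Submodule.subset_span ⟨φ, fun x u hx => ?_, leftFun_eq_wordFun hR hr φ hφl hφr⟩
    exact ⟨_, (hclosed r).1 hr x, (hφr x u hx).2, (hφr x u hx).1⟩
  · rw [wordSpan, Submodule.span_le]
    rintro _ ⟨φ, hφ, rfl⟩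
    choose! a ha using hφ
    let r : Set (α × X) := {p | p.1 ∈ Sum.elim (downSet R) (a p.2) (φ p.2)}
    have hr : ∀ x, {i | (i, x) ∈ r} = Sum.elim (downSet R) (a x) (φ x) := fun x => rfl
    have hrc : R ⊚ r = r := by
      rw [hclosed]
      intro x
      rw [hr]
      rcases hx : φ x with e | u
      · exact fun i j hij hj => hR.trans _ _ _ hij hj
      · exact (ha x u hx).1
    refine Submodule.subset_span ⟨r, hrc, (leftFun_eq_wordFun hR hrc φ ?_ ?_).symm⟩
    · intro x e hx
      rw [hr, hx]
      rfl
    · intro x u hx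
      rw [hr, hx]
      exact ⟨(ha x u hx).2.2, (ha x u hx).2.1⟩

open Classical in
theorem wordFun_eq_sub {R : Set (α × α)} (e : α) (u v : Set α)
    (huv : u = upSet R e ∧ v = upSet R e \ {e} ∨ u = upSet R e \ {e} ∧ v = upSet R e)
    (φ : X → α ⊕ Set α) :
    wordFun k R φ = wordFun k R (fun x => if φ x = Sum.inr u then Sum.inl e else φ x) -
      wordFun k R (fun x => if φ x = Sum.inr u then Sum.inl e else
        if φ x = Sum.inl e then Sum.inr v else φ x) := by
  funext l
  rw [Pi.sub_apply]
  unfold wordFun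
  set A := (∀ x i, (x, i) ∈ l → i ∈ letterSet R (φ x)) ∧ ∀ e, ∃ x, φ x = Sum.inl e ∧ (x, e) ∈ l
    with hA
  set φ₁ : X → α ⊕ Set α := fun x => if φ x = Sum.inr u then Sum.inl e else φ x with hφ₁
  set φ₂ : X → α ⊕ Set α := fun x => if φ x = Sum.inr u then Sum.inl e else
        if φ x = Sum.inl e then Sum.inr v else φ x with hφ₂
  set B := (∀ x i, (x, i) ∈ l → i ∈ letterSet R (φ₁ x)) ∧ ∀ e, ∃ x, φ₁ x = Sum.inl e ∧ (x, e) ∈ l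
    with hB
  set C := (∀ x i, (x, i) ∈ l → i ∈ letterSet R (φ₂ x)) ∧ ∀ e, ∃ x, φ₂ x = Sum.inl e ∧ (x, e) ∈ l
    with hC
  have hu : u ⊆ upSet R e := by rcases huv with ⟨rfl, rfl⟩ | ⟨rfl, rfl⟩ <;> simp
  have hv : v ⊆ upSet R e := by rcases huv with ⟨rfl, rfl⟩ | ⟨rfl, rfl⟩ <;> simp
  have hAB : A → B := by
    rintro ⟨h1, h2⟩
    refine ⟨fun x i hxi => ?_, fun e' => ?_⟩
    · have := h1 x i hxi
      by_cases hx : φ x = Sum.inr u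
      · rw [hx] at this
        simp only [hφ₁, if_pos hx]
        exact hu this
      · simpa only [hφ₁, if_neg hx] using this
    · obtain ⟨x, hx, hxe⟩ := h2 e'
      exact ⟨x, by simp [hφ₁, hx], hxe⟩
  have hCB : C → B := by
    rintro ⟨h1, h2⟩
    refine ⟨fun x i hxi => ?_, fun e' => ?_⟩
    · have := h1 x i hxi
      by_cases hx : φ x = Sum.inr u
      · simpa only [hφ₂, hφ₁, if_pos hx] using this
      · by_cases hx' : φ x = Sum.inl e
        · simp only [hφ₂, if_neg hx, if_pos hx'] at this
          simp only [hφ₁, if_neg hx, hx']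
          exact hv this
        · simpa only [hφ₂, hφ₁, if_neg hx, if_neg hx'] using this
    · obtain ⟨x, hx, hxe⟩ := h2 e'
      refine ⟨x, ?_, hxe⟩
      by_cases hx1 : φ x = Sum.inr u
      · simpa only [hφ₂, hφ₁, if_pos hx1] using hx
      · by_cases hx' : φ x = Sum.inl e
        · simp [hφ₂, hx'] at hx
        · simpa only [hφ₂, hφ₁, if_neg hx1, if_neg hx'] using hx
  have hAC : A → C → False := by
    rintro ⟨h1, h2⟩ ⟨h3, h4⟩
    rcases huv with ⟨rfl, rfl⟩ | ⟨rfl, rfl⟩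
    · obtain ⟨x, hx, hxe⟩ := h2 e
      have := h3 x e hxe
      simp [hφ₂, hx, letterSet] at this
    · obtain ⟨x, hx, hxe⟩ := h4 e
      by_cases hx1 : φ x = Sum.inr (upSet R e \ {e})
      · have := h1 x e hxe
        simp [hx1, letterSet] at this
      · by_cases hx' : φ x = Sum.inl e
        · simp [hφ₂, hx'] at hx
        · simp only [hφ₂, if_neg hx1, if_neg hx'] at hx
          contradiction
  have hother : ∀ x e', φ₁ x = Sum.inl e' → e' ≠ e → φ x = Sum.inl e' := by
    intro x e' hx hne
    by_cases hx1 : φ x = Sum.inr u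
    · simp only [hφ₁, if_pos hx1, Sum.inl.injEq] at hx
      exact absurd hx.symm hne
    · simpa only [hφ₁, if_neg hx1] using hx
  have hBAC : B → A ∨ C := by
    rintro ⟨h1, h2⟩
    rcases huv with ⟨rfl, rfl⟩ | ⟨rfl, rfl⟩
    · by_cases H : ∃ x, φ x = Sum.inl e ∧ (x, e) ∈ l
      · refine Or.inl ⟨fun x i hxi => ?_, fun e' => ?_⟩
        · have := h1 x i hxi
          by_cases hx : φ x = Sum.inr (upSet R e)
          · simp only [hφ₁, if_pos hx] at this
            rw [hx]; exact this
          · simpa only [hφ₁, if_neg hx] using this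
        · by_cases he : e' = e
          · rw [he]; exact H
          · obtain ⟨x, hx, hxe⟩ := h2 e'
            exact ⟨x, hother x e' hx he, hxe⟩
      · refine Or.inr ⟨fun x i hxi => ?_, fun e' => ?_⟩
        · have := h1 x i hxi
          by_cases hx : φ x = Sum.inr (upSet R e)
          · simpa only [hφ₁, hφ₂, if_pos hx] using this
          · by_cases hx' : φ x = Sum.inl e
            · simp only [hφ₂, if_neg hx, if_pos hx']
              simp only [hφ₁, if_neg hx, hx'] at this
              refine ⟨this, ?_⟩
              rintro rfl
              exact H ⟨x, hx', hxi⟩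
            · simpa only [hφ₁, hφ₂, if_neg hx, if_neg hx'] using this
        · obtain ⟨x, hx, hxe⟩ := h2 e'
          refine ⟨x, ?_, hxe⟩
          by_cases he : e' = e
          · subst he
            by_cases hx1 : φ x = Sum.inr (upSet R e')
            · simp only [hφ₂, if_pos hx1]
            · simp only [hφ₁, if_neg hx1] at hx
              exact absurd ⟨x, hx, hxe⟩ H
          · have := hother x e' hx he
            simp [hφ₂, this, he]
    · by_cases H : ∃ x, φ x = Sum.inr (upSet R e \ {e}) ∧ (x, e) ∈ l
      · refine Or.inr ⟨fun x i hxi => ?_, fun e' => ?_⟩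
        · have := h1 x i hxi
          by_cases hx : φ x = Sum.inr (upSet R e \ {e})
          · simpa only [hφ₁, hφ₂, if_pos hx] using this
          · by_cases hx' : φ x = Sum.inl e
            · simp only [hφ₂, if_neg hx, if_pos hx']
              simp only [hφ₁, if_neg hx, hx'] at this
              exact this
            · simpa only [hφ₁, hφ₂, if_neg hx, if_neg hx'] using this
        · by_cases he : e' = e
          · obtain ⟨x, hx, hxe⟩ := H
            exact ⟨x, by simp [hφ₂, hx, he], he ▸ hxe⟩
          · obtain ⟨x, hx, hxe⟩ := h2 e'
            have := hother x e' hx he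
            exact ⟨x, by simp [hφ₂, this, he], hxe⟩
      · refine Or.inl ⟨fun x i hxi => ?_, fun e' => ?_⟩
        · have := h1 x i hxi
          by_cases hx : φ x = Sum.inr (upSet R e \ {e})
          · simp only [hφ₁, if_pos hx] at this
            rw [hx]
            refine ⟨this, ?_⟩
            rintro rfl
            exact H ⟨x, hx, hxi⟩
          · simpa only [hφ₁, if_neg hx] using this
        · obtain ⟨x, hx, hxe⟩ := h2 e'
          refine ⟨x, ?_, hxe⟩
          by_cases he : e' = e
          · subst he
            by_cases hx1 : φ x = Sum.inr (upSet R e' \ {e'})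
            · exact absurd ⟨x, hx1, hxe⟩ H
            · simpa only [hφ₁, if_neg hx1] using hx
          · exact hother x e' hx he
  clear_value A B C
  subst hA hB hC
  split_ifs with a b c c b c c
  all_goals first
    | exact (hAC a c).elim
    | exact absurd (hAB a) b
    | exact absurd (hCB c) b
    | exact absurd b (fun b => (hBAC b).elim a c)
    | simp

end Words

section Stripping

variable {k α X : Type*} [Field k] {R : Set (α × α)}

theorem upSet_injective (hR : IsOrd R) : Function.Injective (upSet R) := by
  intro i j h
  apply hR.antisymm
  · show j ∈ upSet R i
    rw [h]; exact hR.refl j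
  · show i ∈ upSet R j
    rw [← h]; exact hR.refl i

theorem strip_upSet (hR : IsOrd R) (e : α) : strip R (upSet R e) = upSet R e \ {e} := by
  ext i
  simp only [strip, Set.mem_ofPred_eq, Set.mem_sdiff, Set.mem_singleton_iff]
  refine and_congr_right fun _ => not_congr ⟨fun h => (upSet_injective hR h).symm, ?_⟩
  rintro rfl; rfl

theorem strip_eq_self {u : Set α} (h : ∀ e, u ≠ upSet R e) : strip R u = u := by
  ext i
  simp [strip, h]

theorem strip_subset (u : Set α) : strip R u ⊆ u := fun _ h => h.1

theorem isUp_strip (hR : IsOrd R) {u : Set α} (hu : IsUp R u) : IsUp R (strip R u) := by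
  rintro i j hij ⟨h1, h2⟩
  refine ⟨hu i j hij h1, ?_⟩
  rintro rfl
  have : j = i := hR.antisymm _ _ h1 hij
  exact h2 (this ▸ rfl)

theorem isUp_ubSet (hR : IsOrd R) (a : Set α) : IsUp R (ubSet R a) :=
  fun _ _ hij hi m hm => hR.trans _ _ _ (hi m hm) hij

theorem isUp_of_mem_strippedSets (hR : IsOrd R) {u : Set α} (hu : u ∈ strippedSets R) :
    IsUp R u := by
  obtain ⟨_, ⟨a, -, -, rfl⟩, rfl⟩ := hu
  have : ∀ n, IsUp R ((strip R)^[n] (ubSet R a)) := by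
    intro n
    induction n with
    | zero => exact isUp_ubSet hR a
    | succ n ih => rw [Function.iterate_succ_apply']; exact isUp_strip hR ih
  exact this _

theorem strip_eq_self_iff (hR : IsOrd R) {u : Set α} : strip R u = u ↔ ∀ e, u ≠ upSet R e := by
  refine ⟨?_, strip_eq_self⟩
  rintro h e rfl
  rw [strip_upSet hR] at h
  have : e ∈ upSet R e \ {e} := by rw [h]; exact hR.refl e
  exact this.2 rfl

theorem strip_stripAll [Finite α] (u : Set α) : strip R (stripAll R u) = stripAll R u := by
  have key : ∀ n, strip R ((strip R)^[n] u) = (strip R)^[n] u ∨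
      ((strip R)^[n] u).ncard + n ≤ Nat.card α := by
    intro n
    induction n with
    | zero => right; simpa using Set.ncard_le_card u
    | succ n ih =>
      rw [Function.iterate_succ_apply']
      rcases ih with h | h
      · left; rw [h, h]
      · by_cases h1 : strip R ((strip R)^[n] u) = (strip R)^[n] u
        · left; rw [h1, h1]
        · right
          have := Set.ncard_lt_ncard ((strip_subset _).ssubset_of_ne h1) (Set.toFinite _)
          omega
  rcases key (Nat.card α) with h | h
  · exact h
  · have h1 : ((strip R)^[Nat.card α] u).ncard = 0 := by omega
    rw [Set.ncard_eq_zero] at h1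
    apply (strip_subset _).antisymm
    rw [stripAll, h1]
    exact Set.empty_subset _

theorem ne_upSet_of_mem_strippedSets [Finite α] (hR : IsOrd R) {u : Set α}
    (hu : u ∈ strippedSets R) (e : α) : u ≠ upSet R e := by
  obtain ⟨v, -, rfl⟩ := hu
  exact (strip_eq_self_iff hR).1 (strip_stripAll v) e

theorem wordSpan_insert_le {e : α} {u v : Set α} (T : Set (Set α))
    (huv : u = upSet R e ∧ v = upSet R e \ {e} ∨ u = upSet R e \ {e} ∧ v = upSet R e) :
    wordSpan k X R (insert u T) ≤ wordSpan k X R (insert v T) := by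
  classical
  rw [wordSpan, Submodule.span_le]
  rintro _ ⟨φ, hφ, rfl⟩
  rw [wordFun_eq_sub e u v huv φ]
  refine sub_mem (Submodule.subset_span ⟨_, ?_, rfl⟩) (Submodule.subset_span ⟨_, ?_, rfl⟩)
  · intro x w hx
    split_ifs at hx with h
    rcases hφ x w hx with rfl | h'
    · exact absurd hx h
    · exact Or.inr h'
  · intro x w hx
    split_ifs at hx with h h'
    · exact Or.inl (Sum.inr.inj hx).symm
    · rcases hφ x w hx with rfl | h'
      · exact absurd hx h
      · exact Or.inr h'

theorem wordSpan_insert_strip (hR : IsOrd R) (u : Set α) (T : Set (Set α)) :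
    wordSpan k X R (insert (strip R u) T) = wordSpan k X R (insert u T) := by
  by_cases h : ∃ e, u = upSet R e
  · obtain ⟨e, rfl⟩ := h
    rw [strip_upSet hR]
    exact le_antisymm (wordSpan_insert_le T (Or.inr ⟨rfl, rfl⟩))
      (wordSpan_insert_le T (Or.inl ⟨rfl, rfl⟩))
  · rw [strip_eq_self (not_exists.1 h)]

theorem wordSpan_insert_stripAll (hR : IsOrd R) (u : Set α) (T : Set (Set α)) :
    wordSpan k X R (insert (stripAll R u) T) = wordSpan k X R (insert u T) := by
  rw [stripAll]
  generalize Nat.card α = n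
  induction n with
  | zero => rfl
  | succ n ih => rw [Function.iterate_succ_apply', wordSpan_insert_strip hR, ih]

theorem wordSpan_image_stripAll [Finite α] (hR : IsOrd R) (S : Set (Set α)) :
    wordSpan k X R (stripAll R '' S) = wordSpan k X R S := by
  suffices ∀ T, wordSpan k X R (stripAll R '' S ∪ T) = wordSpan k X R (S ∪ T) by
    simpa using this ∅
  induction S, Set.toFinite S using Set.Finite.induction_on with
  | empty => simp
  | insert _ _ ih =>
    intro T
    rw [Set.image_insert_eq, Set.insert_union, wordSpan_insert_stripAll hR, Set.insert_union,
      ← Set.union_insert, ih, Set.union_insert]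

theorem span_leftFun' [Finite α] (hR : IsOrd R) :
    Submodule.span k {f | ∃ r : Set (α × X), R ⊚ r = r ∧ f = leftFun k R r} =
      wordSpan k X R (strippedSets R) := by
  rw [span_leftFun hR, strippedSets, wordSpan_image_stripAll hR]

/-- The words with letters in `α ⊕ strippedSets R` in which every element of `α` occurs. -/
structure IsWord (R : Set (α × α)) (φ : X → α ⊕ Set α) : Prop where
  mem : ∀ x u, φ x = Sum.inr u → u ∈ strippedSets R
  hits : ∀ e, ∃ x, φ x = Sum.inl e

theorem wordSpan_strippedSets :
    wordSpan k X R (strippedSets R) =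
      Submodule.span k {f | ∃ φ : X → α ⊕ Set α, IsWord R φ ∧ f = wordFun k R φ} := by
  apply le_antisymm
  · rw [wordSpan, Submodule.span_le]
    rintro _ ⟨φ, hφ, rfl⟩
    by_cases h : ∀ e, ∃ x, φ x = Sum.inl e
    · exact Submodule.subset_span ⟨φ, ⟨hφ, h⟩, rfl⟩
    · have : wordFun k R φ = 0 := by
        funext l
        rw [wordFun, if_neg]
        · rfl
        · exact fun h' => h fun e => (h'.2 e).imp fun _ h => h.1
      rw [this]
      exact zero_mem _
  · exact Submodule.span_mono fun _ ⟨φ, h1, h2⟩ => ⟨φ, h1.mem, h2⟩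

/-- The largest relation on which `wordFun R φ` does not vanish. -/
def wordTop (R : Set (α × α)) (φ : X → α ⊕ Set α) : Set (X × α) := {p | p.2 ∈ letterSet R (φ p.1)}

theorem wordFun_wordTop (hR : IsOrd R) {φ : X → α ⊕ Set α} (hφ : IsWord R φ) :
    wordFun k R φ (wordTop R φ) = 1 := by
  rw [wordFun, if_pos]
  refine ⟨fun _ _ h => h, fun e => ?_⟩
  obtain ⟨x, hx⟩ := hφ.hits e
  refine ⟨x, hx, ?_⟩
  simp only [wordTop, Set.mem_ofPred_eq, hx]
  exact hR.refl e

theorem subset_wordTop_of_wordFun_ne_zero {φ : X → α ⊕ Set α} {l : Set (X × α)}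
    (h : wordFun k R φ l ≠ 0) : l ⊆ wordTop R φ := by
  rw [wordFun] at h
  split_ifs at h with h'
  · exact fun p hp => h'.1 p.1 p.2 hp
  · exact absurd rfl h

theorem wordTop_injective [Finite α] {R' : Set (α × α)} (hR : IsOrd R) (hR' : IsOrd R')
    {φ φ' : X → α ⊕ Set α} (hφ : IsWord R φ) (hφ' : IsWord R' φ')
    (h : wordTop R φ = wordTop R' φ') : R = R' ∧ φ = φ' := by
  have hs : ∀ x, letterSet R (φ x) = letterSet R' (φ' x) := fun x => by
    ext i; exact Set.ext_iff.1 h (x, i)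
  have hup : ∀ {R : Set (α × α)} (_ : IsOrd R) {φ : X → α ⊕ Set α} (_ : IsWord R φ) (x : X)
      (i j : α), (i, j) ∈ R → i ∈ letterSet R (φ x) → j ∈ letterSet R (φ x) := by
    intro R hR φ hφ x i j hij hi
    rcases hx : φ x with e | u
    · rw [hx] at hi
      exact hR.trans _ _ _ hi hij
    · rw [hx] at hi
      exact isUp_of_mem_strippedSets hR (hφ.mem x u hx) i j hij hi
  have hle : ∀ {R R' : Set (α × α)} (_ : IsOrd R) (_ : IsOrd R') {φ φ' : X → α ⊕ Set α}
      (_ : IsWord R φ) (_ : IsWord R' φ'), (∀ x, letterSet R (φ x) = letterSet R' (φ' x)) →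
      R ⊆ R' := by
    intro R R' hR hR' φ φ' hφ hφ' hs
    rintro ⟨i, j⟩ hij
    obtain ⟨x, hx⟩ := hφ'.hits i
    have h1 : i ∈ letterSet R' (φ' x) := by rw [hx]; exact hR'.refl i
    rw [← hs] at h1
    have h2 := hup hR hφ x i j hij h1
    rw [hs, hx] at h2
    exact h2
  have hRR : R = R' :=
    (hle hR hR' hφ hφ' hs).antisymm (hle hR' hR hφ' hφ fun x => (hs x).symm)
  subst hRR
  refine ⟨rfl, funext fun x => ?_⟩
  have := hs x
  rcases hx : φ x with e | u <;> rcases hx' : φ' x with e' | u' <;>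
    simp only [hx, hx', letterSet, Sum.elim_inl, Sum.elim_inr, id] at this
  · rw [upSet_injective hR this]
  · exact absurd this.symm (ne_upSet_of_mem_strippedSets hR (hφ'.mem x u' hx') e)
  · exact absurd this (ne_upSet_of_mem_strippedSets hR (hφ.mem x u hx) e')
  · rw [this]

end Stripping

section Pairing

open Equiv

variable {k α β X : Type*} [Field k]

/-- The transpose of a relation. -/
def transp (A : Set (α × β)) : Set (β × α) := {p | (p.2, p.1) ∈ A}

theorem transp_rcomp {γ : Type*} (A : Set (α × β)) (B : Set (β × γ)) :
    transp (A ⊚ B) = transp B ⊚ transp A := by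
  ext ⟨i, j⟩
  exact ⟨fun ⟨y, h1, h2⟩ => ⟨y, h2, h1⟩, fun ⟨y, h1, h2⟩ => ⟨y, h2, h1⟩⟩

theorem transp_inj {A B : Set (α × β)} : transp A = transp B ↔ A = B :=
  ⟨fun h => congrArg transp h, fun h => h ▸ rfl⟩

theorem IsOrd.transp {R : Set (α × α)} (hR : IsOrd R) : IsOrd (transp R) where
  refl := hR.refl
  trans _ _ _ h1 h2 := hR.trans _ _ _ h2 h1
  antisymm _ _ h1 h2 := hR.antisymm _ _ h2 h1

/-- Relabel the columns of a relation by a permutation. -/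
def relabel (σ : Perm α) (l : Set (X × α)) : Set (X × α) := {p | (p.1, σ⁻¹ p.2) ∈ l}

theorem rcomp_relabel (σ : Perm α) (r : Set (β × X)) (l : Set (X × α)) :
    r ⊚ relabel σ l = relabel σ (r ⊚ l) := rfl

theorem injective_factor {R : Set (α × α)} (hR : IsOrd R) {A : Set (α × β)} {A' : Set (β × α)}
    (h : A ⊚ A' = R) : ∃ f : α → β, Function.Injective f ∧ ∀ i, (i, f i) ∈ A ∧ (f i, i) ∈ A' := by
  have : ∀ i, ∃ m, (i, m) ∈ A ∧ (m, i) ∈ A' := fun i => by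
    have : (i, i) ∈ A ⊚ A' := h ▸ hR.refl i
    exact this
  choose f hf using this
  refine ⟨f, fun i j hij => hR.antisymm i j ?_ ?_, hf⟩
  · rw [← h]; exact ⟨f i, (hf i).1, hij ▸ (hf j).2⟩
  · rw [← h]; exact ⟨f j, (hf j).1, hij ▸ (hf i).2⟩

theorem relabel_eq_iff {A : Set (X × α)} {R : Set (X × α)} {σ : Perm α} :
    relabel σ A = R ↔ ∀ i m, (i, m) ∈ A ↔ (i, σ m) ∈ R := by
  constructor
  · rintro rfl i m
    simp [relabel]
  · intro h
    ext ⟨i, m⟩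
    simp [relabel, h]

open Classical in
theorem ite_rcomp_eq_sum_perm [Fintype α] {R : Set (α × α)} (hR : IsOrd R) {A A' : Set (α × α)}
    (hA : R ⊚ A = A) (hA' : A' ⊚ R = A') :
    (if A ⊚ A' = R then (1 : k) else 0) =
      ∑ σ : Perm α, (if relabel σ A = R then 1 else 0) *
        (if relabel σ (transp A') = transp R then 1 else 0) := by
  have hP : ∀ σ : Perm α, relabel σ A = R ∧ relabel σ (transp A') = transp R ↔
      (∀ i m, (i, m) ∈ A ↔ (i, σ m) ∈ R) ∧ ∀ i m, (m, i) ∈ A' ↔ (σ m, i) ∈ R := fun σ => by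
    rw [relabel_eq_iff, relabel_eq_iff]; rfl
  simp only [ite_zero_mul_ite_zero, mul_one, hP]
  by_cases h : A ⊚ A' = R
  · obtain ⟨f, hf, hfA⟩ := injective_factor hR h
    let σ : Perm α := (Equiv.ofBijective f (Finite.injective_iff_bijective.1 hf)).symm
    have hfσ : ∀ m, f (σ m) = m := fun m =>
      (Equiv.ofBijective f (Finite.injective_iff_bijective.1 hf)).apply_symm_apply m
    have hσ : (∀ i m, (i, m) ∈ A ↔ (i, σ m) ∈ R) ∧ ∀ i m, (m, i) ∈ A' ↔ (σ m, i) ∈ R := by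
      refine ⟨fun i m => ⟨fun him => ?_, fun him => ?_⟩, fun i m => ⟨fun him => ?_, fun him => ?_⟩⟩
      · rw [← h]
        exact ⟨m, him, by have := (hfA (σ m)).2; rwa [hfσ] at this⟩
      · rw [← hA]
        exact ⟨σ m, him, by have := (hfA (σ m)).1; rwa [hfσ] at this⟩
      · rw [← h]
        exact ⟨m, by have := (hfA (σ m)).1; rwa [hfσ] at this, him⟩
      · rw [← hA']
        exact ⟨σ m, by have := (hfA (σ m)).2; rwa [hfσ] at this, him⟩
    rw [if_pos h, Finset.sum_eq_single σ, if_pos hσ]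
    · intro τ _ hτ
      rw [if_neg]
      rintro ⟨h1, -⟩
      apply hτ
      ext m
      have h2 : ∀ i, (i, τ m) ∈ R ↔ (i, σ m) ∈ R := fun i => by rw [← h1, hσ.1]
      exact hR.antisymm _ _ ((h2 _).1 (hR.refl _)) ((h2 _).2 (hR.refl _))
    · simp
  · rw [if_neg h]
    symm
    apply Finset.sum_eq_zero
    intro σ _
    rw [if_neg]
    rintro ⟨h1, h2⟩
    apply h
    ext ⟨i, j⟩
    constructor
    · rintro ⟨m, h3, h4⟩
      exact hR.trans _ _ _ ((h1 _ _).1 h3) ((h2 _ _).1 h4)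
    · intro hij
      refine ⟨σ⁻¹ i, (h1 _ _).2 ?_, (h2 _ _).2 ?_⟩ <;> simp [hR.refl, hij]

theorem leftFun_transp_rcomp (R : Set (α × α)) (s r : Set (α × X)) (Q : Set (X × X)) :
    leftFun k (transp R) s (transp (r ⊚ Q)) = leftFun k R r (Q ⊚ transp s) := by
  have : s ⊚ transp (r ⊚ Q) = transp R ↔ r ⊚ (Q ⊚ transp s) = R := by
    rw [← transp_inj, transp_rcomp, ← rcomp_assoc]; rfl
  simp only [leftFun, this]

variable [Fintype α] [Fintype X]

/-- The function `Q ↦ ∑ r, c r * g ((r Q)ᵀ)`. -/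
def pairFun (c : Set (α × X) → k) (g : Set (X × α) → k) (Q : Set (X × X)) : k :=
  ∑ r, c r * g (transp (r ⊚ Q))

theorem exists_coeff_of_mem_span {R : Set (α × α)} {f : Set (X × α) → k}
    (hf : f ∈ Submodule.span k {f | ∃ r : Set (α × X), R ⊚ r = r ∧ f = leftFun k R r}) :
    ∃ c : Set (α × X) → k, (∀ r, c r ≠ 0 → R ⊚ r = r) ∧ f = ∑ r, c r • leftFun k R r := by
  classical
  induction hf using Submodule.span_induction with
  | mem f hf =>
    obtain ⟨r, hr, rfl⟩ := hf
    refine ⟨Pi.single r 1, fun r' hr' => ?_, ?_⟩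
    · by_cases h : r' = r
      · rw [h, hr]
      · exact absurd (Pi.single_eq_of_ne h 1) hr'
    · rw [Finset.sum_eq_single r]
      · simp
      · intro b _ hb; rw [Pi.single_eq_of_ne hb, zero_smul]
      · simp
  | zero => exact ⟨0, by simp, by simp⟩
  | add f g _ _ hf hg =>
    obtain ⟨c, hc, rfl⟩ := hf
    obtain ⟨d, hd, rfl⟩ := hg
    refine ⟨c + d, fun r hr => ?_, by simp [add_smul, Finset.sum_add_distrib]⟩
    by_contra H
    apply hr
    rw [Pi.add_apply, by_contra fun h => H (hc r h), by_contra fun h => H (hd r h), add_zero]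
  | smul a f _ hf =>
    obtain ⟨c, hc, rfl⟩ := hf
    refine ⟨a • c, fun r hr => hc r fun h => hr ?_, by simp [Finset.smul_sum, mul_smul]⟩
    rw [Pi.smul_apply, h, smul_zero]

theorem pairFun_add (c : Set (α × X) → k) (g g' : Set (X × α) → k) :
    pairFun c (g + g') = pairFun c g + pairFun c g' := by
  funext Q
  simp [pairFun, mul_add, Finset.sum_add_distrib]

theorem pairFun_smul (a : k) (c : Set (α × X) → k) (g : Set (X × α) → k) :
    pairFun c (a • g) = a • pairFun c g := by
  funext Q
  simp [pairFun, Finset.mul_sum, mul_left_comm]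

theorem pairFun_leftFun (R : Set (α × α)) (c : Set (α × X) → k) (s : Set (α × X))
    (Q : Set (X × X)) : pairFun c (leftFun k (transp R) s) Q =
      (∑ r, c r • leftFun k R r) (Q ⊚ transp s) := by
  simp [pairFun, leftFun_transp_rcomp]

/-- `pairFun c g` depends on `c` only through `∑ r, c r • leftFun R r`. -/
theorem pairFun_congr {R : Set (α × α)} {c d : Set (α × X) → k}
    (h : ∑ r, c r • leftFun k R r = ∑ r, d r • leftFun k R r) {g : Set (X × α) → k}
    (hg : g ∈ Submodule.span k {f | ∃ s : Set (α × X), transp R ⊚ s = s ∧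
      f = leftFun k (transp R) s}) : pairFun c g = pairFun d g := by
  induction hg using Submodule.span_induction with
  | mem g hg =>
    obtain ⟨s, -, rfl⟩ := hg
    funext Q
    rw [pairFun_leftFun, pairFun_leftFun, h]
  | zero => funext Q; simp [pairFun]
  | add g g' _ _ hg hg' => rw [pairFun_add, pairFun_add, hg, hg']
  | smul a g _ hg => rw [pairFun_smul, pairFun_smul, hg]

theorem pairFun_rcomp_eq_zero [Fintype β] (hβ : Fintype.card β < Fintype.card α)
    {R : Set (α × α)} (hR : IsOrd R) (c : Set (α × X) → k) {g : Set (X × α) → k}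
    (hg : g ∈ Submodule.span k {f | ∃ s : Set (α × X), transp R ⊚ s = s ∧
      f = leftFun k (transp R) s}) (l : Set (X × β)) (r : Set (β × X)) :
    pairFun c g (l ⊚ r) = 0 := by
  induction hg using Submodule.span_induction with
  | mem g hg =>
    obtain ⟨s, -, rfl⟩ := hg
    rw [pairFun_leftFun, Finset.sum_apply]
    apply Finset.sum_eq_zero
    intro t _
    rw [Pi.smul_apply, leftFun, if_neg, smul_zero]
    intro h
    rw [rcomp_assoc l, ← rcomp_assoc t] at h
    obtain ⟨f, hf, -⟩ := injective_factor hR h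
    exact absurd (Fintype.card_le_of_injective f hf) (by omega)
  | zero => simp [pairFun]
  | add g g' _ _ hg hg' => rw [pairFun_add, Pi.add_apply, hg, hg', add_zero]
  | smul a g _ hg => rw [pairFun_smul, Pi.smul_apply, hg, smul_zero]

theorem pairFun_rcomp [DecidableEq α] {R : Set (α × α)} (hR : IsOrd R) {c : Set (α × X) → k}
    (hc : ∀ r, c r ≠ 0 → R ⊚ r = r) {g : Set (X × α) → k}
    (hg : g ∈ Submodule.span k {f | ∃ s : Set (α × X), transp R ⊚ s = s ∧
      f = leftFun k (transp R) s}) (l : Set (X × α)) (r : Set (α × X)) :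
    pairFun c g (l ⊚ r) = ∑ σ : Perm α,
      (∑ r, c r • leftFun k R r) (relabel σ l) * g (relabel σ (transp r)) := by
  induction hg using Submodule.span_induction with
  | mem g hg =>
    obtain ⟨s, hs, rfl⟩ := hg
    rw [pairFun_leftFun]
    simp only [Finset.sum_apply, Finset.sum_mul]
    rw [Finset.sum_comm]
    refine Finset.sum_congr rfl fun t _ => ?_
    by_cases ht : c t = 0
    · simp [ht]
    simp only [Pi.smul_apply, smul_eq_mul, mul_assoc, ← Finset.mul_sum]
    congr 1
    have h1 : R ⊚ (t ⊚ l) = t ⊚ l := by rw [← rcomp_assoc, hc t ht]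
    have h2 : (r ⊚ transp s) ⊚ R = r ⊚ transp s := by
      have : transp s ⊚ R = transp s := by
        conv_rhs => rw [← hs, transp_rcomp]
        rfl
      rw [rcomp_assoc, this]
    have := ite_rcomp_eq_sum_perm (k := k) hR h1 h2
    simp only [leftFun, rcomp_relabel, transp_rcomp] at this ⊢
    have h3 : transp (transp s) = s := rfl
    rw [h3] at this
    rw [rcomp_assoc l, ← rcomp_assoc t]
    convert this using 3 <;> (split_ifs <;> simp_all)
  | zero => simp [pairFun]
  | add g g' _ _ hg hg' =>
    rw [pairFun_add, Pi.add_apply, hg, hg', ← Finset.sum_add_distrib]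
    simp only [Pi.add_apply, mul_add]
  | smul a g _ hg =>
    rw [pairFun_smul, Pi.smul_apply, hg, smul_eq_mul, Finset.mul_sum]
    simp only [Pi.smul_apply, smul_eq_mul, mul_left_comm]

end Pairing

section Equivariance

open Equiv Pointwise

variable {k α X : Type*} [Field k]

theorem mem_perm_smul {R : Set (α × α)} {σ : Perm α} {i j : α} :
    (i, j) ∈ σ • R ↔ (σ⁻¹ i, σ⁻¹ j) ∈ R := by
  rw [Set.mem_smul_set_iff_inv_smul_mem]; rfl

theorem mem_perm_smul' {u : Set α} {σ : Perm α} {i : α} : i ∈ σ • u ↔ σ⁻¹ i ∈ u := by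
  rw [Set.mem_smul_set_iff_inv_smul_mem]; rfl

theorem IsOrd.smul {R : Set (α × α)} (hR : IsOrd R) (σ : Perm α) : IsOrd (σ • R) where
  refl _ := mem_perm_smul.2 (hR.refl _)
  trans _ _ _ h1 h2 := mem_perm_smul.2 (hR.trans _ _ _ (mem_perm_smul.1 h1) (mem_perm_smul.1 h2))
  antisymm _ _ h1 h2 := σ⁻¹.injective
    (hR.antisymm _ _ (mem_perm_smul.1 h1) (mem_perm_smul.1 h2))

theorem transp_smul (R : Set (α × α)) (σ : Perm α) : transp (σ • R) = σ • transp R := by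
  ext ⟨i, j⟩
  rw [mem_perm_smul]
  exact mem_perm_smul

theorem upSet_smul (R : Set (α × α)) (σ : Perm α) (e : α) :
    upSet (σ • R) (σ e) = σ • upSet R e := by
  ext i
  rw [mem_perm_smul']
  exact mem_perm_smul.trans (by simp [upSet])

theorem downSet_smul (R : Set (α × α)) (σ : Perm α) (e : α) :
    downSet (σ • R) (σ e) = σ • downSet R e := by
  ext i
  rw [mem_perm_smul']
  exact mem_perm_smul.trans (by simp [downSet])

theorem ubSet_smul (R : Set (α × α)) (σ : Perm α) (a : Set α) :
    ubSet (σ • R) (σ • a) = σ • ubSet R a := by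
  ext i
  rw [mem_perm_smul']
  constructor
  · intro h j hj
    simpa [mem_perm_smul] using h (σ j) (by simpa [mem_perm_smul'] using hj)
  · intro h j hj
    exact mem_perm_smul.2 (h _ (mem_perm_smul'.1 hj))

theorem IsDown.smul {R : Set (α × α)} {a : Set α} (ha : IsDown R a) (σ : Perm α) :
    IsDown (σ • R) (σ • a) := fun _ _ hij hj =>
  mem_perm_smul'.2 (ha _ _ (mem_perm_smul.1 hij) (mem_perm_smul'.1 hj))

theorem strip_smul (R : Set (α × α)) (σ : Perm α) (u : Set α) :
    strip (σ • R) (σ • u) = σ • strip R u := by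
  ext i
  rw [mem_perm_smul']
  refine and_congr mem_perm_smul' (not_congr ?_)
  have := upSet_smul R σ (σ⁻¹ i)
  rw [show σ (σ⁻¹ i) = i from σ.apply_symm_apply i] at this
  rw [this, smul_left_cancel_iff]

theorem stripAll_smul (R : Set (α × α)) (σ : Perm α) (u : Set α) :
    stripAll (σ • R) (σ • u) = σ • stripAll R u := by
  rw [stripAll, stripAll]
  induction Nat.card α generalizing u with
  | zero => rfl
  | succ n ih => rw [Function.iterate_succ_apply, Function.iterate_succ_apply, strip_smul, ih]

theorem smul_mem_strippedSets {R : Set (α × α)} {u : Set α} (hu : u ∈ strippedSets R)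
    (σ : Perm α) : σ • u ∈ strippedSets (σ • R) := by
  obtain ⟨_, ⟨a, ha, hne, rfl⟩, rfl⟩ := hu
  refine ⟨_, ⟨σ • a, ha.smul σ, fun e he => ?_, rfl⟩, ?_⟩
  · have := downSet_smul R σ (σ⁻¹ e)
    rw [show σ (σ⁻¹ e) = e from σ.apply_symm_apply e] at this
    rw [this, smul_left_cancel_iff] at he
    exact hne _ he
  · rw [ubSet_smul, stripAll_smul]

/-- The action of permutations on words. -/
def wordSmul (σ : Perm α) (φ : X → α ⊕ Set α) : X → α ⊕ Set α :=
  fun x => Sum.map σ (fun u => σ • u) (φ x)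

theorem letterSet_smul (R : Set (α × α)) (σ : Perm α) (a : α ⊕ Set α) :
    letterSet (σ • R) (Sum.map σ (fun u => σ • u) a) = σ • letterSet R a := by
  rcases a with e | u
  · exact upSet_smul R σ e
  · rfl

theorem wordSmul_eq_inl {σ : Perm α} {φ : X → α ⊕ Set α} {x : X} {e : α} :
    wordSmul σ φ x = Sum.inl e ↔ φ x = Sum.inl (σ⁻¹ e) := by
  rw [wordSmul]
  rcases φ x with a | u
  · simp only [Sum.map_inl, Sum.inl.injEq]
    exact Perm.eq_inv_iff_eq.symm
  · simp

theorem IsWord.smul {R : Set (α × α)} {φ : X → α ⊕ Set α} (hφ : IsWord R φ) (σ : Perm α) :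
    IsWord (σ • R) (wordSmul σ φ) where
  mem x u hu := by
    rw [wordSmul] at hu
    rcases h : φ x with a | v
    · rw [h] at hu; simp at hu
    · rw [h] at hu
      obtain rfl : σ • v = u := by simpa using hu
      exact smul_mem_strippedSets (hφ.mem x v h) σ
  hits e := (hφ.hits (σ⁻¹ e)).imp fun _ hx => wordSmul_eq_inl.2 hx

theorem mem_relabel {σ : Perm α} {l : Set (X × α)} {x : X} {i : α} :
    (x, i) ∈ relabel σ l ↔ (x, σ⁻¹ i) ∈ l := Iff.rfl

theorem wordFun_smul (R : Set (α × α)) (σ : Perm α) (φ : X → α ⊕ Set α) (l : Set (X × α)) :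
    wordFun k (σ • R) (wordSmul σ φ) (relabel σ l) = wordFun k R φ l := by
  rw [wordFun, wordFun]
  congr 1
  apply propext
  refine and_congr ?_ ?_
  · refine forall_congr' fun x => σ⁻¹.forall_congr fun i => ?_
    rw [mem_relabel, wordSmul, letterSet_smul, mem_perm_smul']
  · refine σ⁻¹.forall_congr fun e => exists_congr fun x => ?_
    rw [wordSmul_eq_inl, mem_relabel]

/-- Relabel the rows of a relation by a permutation. -/
def rowRelabel (σ : Perm α) (r : Set (α × X)) : Set (α × X) := {p | (σ⁻¹ p.1, p.2) ∈ r}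

theorem transp_rowRelabel (σ : Perm α) (r : Set (α × X)) :
    transp (rowRelabel σ r) = relabel σ (transp r) := rfl

theorem rowRelabel_rcomp (σ : Perm α) (r : Set (α × X)) (Q : Set (X × X)) :
    rowRelabel σ (r ⊚ Q) = rowRelabel σ r ⊚ Q := rfl

theorem leftFun_smul (R : Set (α × α)) (σ : Perm α) (r : Set (α × X)) (l : Set (X × α)) :
    leftFun k (σ • R) (rowRelabel σ r) (relabel σ l) = leftFun k R r l := by
  have : rowRelabel σ r ⊚ relabel σ l = σ • (r ⊚ l) := by
    ext ⟨i, j⟩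
    rw [mem_perm_smul]
    rfl
  rw [leftFun, leftFun, this]
  simp only [smul_left_cancel_iff]

/-- `rowRelabel σ` as a permutation. -/
def rowRelabelEquiv (σ : Perm α) : Set (α × X) ≃ Set (α × X) where
  toFun := rowRelabel σ
  invFun := rowRelabel σ⁻¹
  left_inv r := by ext ⟨i, x⟩; simp [rowRelabel]
  right_inv r := by ext ⟨i, x⟩; simp [rowRelabel]

theorem relabel_relabel_inv (σ : Perm α) (l : Set (X × α)) : relabel σ (relabel σ⁻¹ l) = l := by
  ext ⟨x, i⟩; simp [relabel]

end Equivariance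

section BiWord

open Equiv Pointwise

/-- A partial order on `α` with a word for it and a word for its opposite. -/
@[ext]
structure BiWord (α X : Type*) where
  rel : Set (α × α)
  left : X → α ⊕ Set α
  right : X → α ⊕ Set α
  isOrd : IsOrd rel
  isWord_left : IsWord rel left
  isWord_right : IsWord (transp rel) right

variable {k α X : Type*} [Field k]

instance : MulAction (Perm α) (BiWord α X) where
  smul σ ω := ⟨σ • ω.rel, wordSmul σ ω.left, wordSmul σ ω.right, ω.isOrd.smul σ,
    ω.isWord_left.smul σ, by rw [transp_smul]; exact ω.isWord_right.smul σ⟩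
  one_smul ω := by
    ext1
    · exact one_smul _ ω.rel
    · funext x
      change Sum.map _ _ (ω.left x) = _
      rcases ω.left x with a | u <;> simp
    · funext x
      change Sum.map _ _ (ω.right x) = _
      rcases ω.right x with a | u <;> simp
  mul_smul σ τ ω := by
    ext1
    · exact mul_smul _ _ ω.rel
    · funext x
      change Sum.map _ _ (ω.left x) = Sum.map _ _ (Sum.map _ _ (ω.left x))
      rcases ω.left x with a | u <;> simp [mul_smul]
    · funext x
      change Sum.map _ _ (ω.right x) = Sum.map _ _ (Sum.map _ _ (ω.right x))
      rcases ω.right x with a | u <;> simp [mul_smul]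

theorem BiWord.smul_rel (σ : Perm α) (ω : BiWord α X) : (σ • ω).rel = σ • ω.rel := rfl
theorem BiWord.smul_left (σ : Perm α) (ω : BiWord α X) : (σ • ω).left = wordSmul σ ω.left := rfl
theorem BiWord.smul_right (σ : Perm α) (ω : BiWord α X) :
    (σ • ω).right = wordSmul σ ω.right := rfl

theorem BiWord.stabilizer_eq_bot (ω : BiWord α X) : MulAction.stabilizer (Perm α) ω = ⊥ := by
  rw [eq_bot_iff]
  intro σ hσ
  rw [MulAction.mem_stabilizer_iff] at hσ
  rw [Subgroup.mem_bot]
  ext e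
  obtain ⟨x, hx⟩ := ω.isWord_left.hits e
  have h : wordSmul σ ω.left x = ω.left x := congrFun (congrArg BiWord.left hσ) x
  rw [wordSmul, hx] at h
  simpa using h

instance [Finite α] [Finite X] : Finite (BiWord α X) :=
  Finite.of_injective (fun ω => (ω.rel, ω.left, ω.right)) fun ω ω' h => by
    simp only [Prod.mk.injEq] at h
    exact BiWord.ext h.1 h.2.1 h.2.2

variable [Fintype α] [Fintype X]

theorem wordFun_mem_span {R : Set (α × α)} (hR : IsOrd R) {φ : X → α ⊕ Set α} (hφ : IsWord R φ) :
    wordFun k R φ ∈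
      Submodule.span k {f | ∃ r : Set (α × X), R ⊚ r = r ∧ f = leftFun k R r} := by
  rw [span_leftFun' hR]
  exact Submodule.subset_span ⟨φ, hφ.mem, rfl⟩

theorem exists_biWord_coeff (ω : BiWord α X) : ∃ c : Set (α × X) → k,
    (∀ r, c r ≠ 0 → ω.rel ⊚ r = r) ∧ wordFun k ω.rel ω.left = ∑ r, c r • leftFun k ω.rel r :=
  exists_coeff_of_mem_span (wordFun_mem_span ω.isOrd ω.isWord_left)

/-- The function on relations attached to a pair of words. -/
noncomputable def biFun (k : Type*) [Field k] (ω : BiWord α X) : Set (X × X) → k :=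
  pairFun (exists_biWord_coeff ω).choose (wordFun k (transp ω.rel) ω.right)

theorem biFun_eq {ω : BiWord α X} {c : Set (α × X) → k}
    (hc : wordFun k ω.rel ω.left = ∑ r, c r • leftFun k ω.rel r) :
    biFun k ω = pairFun c (wordFun k (transp ω.rel) ω.right) :=
  pairFun_congr ((exists_biWord_coeff ω).choose_spec.2.symm.trans hc)
    (wordFun_mem_span ω.isOrd.transp ω.isWord_right)

theorem biFun_smul (σ : Perm α) (ω : BiWord α X) : biFun k (σ • ω) = biFun k ω := by
  obtain ⟨c, -, hc⟩ := exists_biWord_coeff (k := k) ω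
  rw [biFun_eq hc, biFun_eq (c := fun r => c ((rowRelabelEquiv σ).symm r))]
  · funext Q
    rw [pairFun, pairFun, ← (rowRelabelEquiv σ).sum_comp]
    refine Finset.sum_congr rfl fun r _ => ?_
    rw [Equiv.symm_apply_apply]
    change _ * wordFun k (transp (σ • ω.rel)) (wordSmul σ ω.right)
      (transp (rowRelabel σ r ⊚ Q)) = _
    rw [← rowRelabel_rcomp, transp_rowRelabel, transp_smul, wordFun_smul]
  · rw [← (rowRelabelEquiv σ).sum_comp]
    funext l
    rw [← relabel_relabel_inv σ l, BiWord.smul_rel, BiWord.smul_left, wordFun_smul, hc,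
      Finset.sum_apply, Finset.sum_apply]
    refine Finset.sum_congr rfl fun r _ => ?_
    rw [Equiv.symm_apply_apply, Pi.smul_apply, Pi.smul_apply]
    change _ = _ • leftFun k (σ • ω.rel) (rowRelabel σ r) _
    rw [leftFun_smul]

theorem biFun_mem_span (ω : BiWord α X) : biFun k ω ∈ Submodule.span k
    {f | ∃ (r : Set (α × X)) (l : Set (X × α)), ω.rel ⊚ r = r ∧ l ⊚ ω.rel = l ∧
      f = orderFun k ω.rel r l} := by
  obtain ⟨c, hc, hcω⟩ := exists_biWord_coeff (k := k) ω
  rw [biFun_eq hcω]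
  have := wordFun_mem_span (k := k) ω.isOrd.transp ω.isWord_right
  generalize wordFun k (transp ω.rel) ω.right = g at this ⊢
  induction this using Submodule.span_induction with
  | mem g hg =>
    obtain ⟨s, hs, rfl⟩ := hg
    have : pairFun c (leftFun k (transp ω.rel) s) =
        ∑ r, c r • orderFun k ω.rel r (transp s) := by
      funext Q
      rw [pairFun_leftFun, Finset.sum_apply, Finset.sum_apply]
      refine Finset.sum_congr rfl fun r _ => ?_
      simp only [Pi.smul_apply, leftFun, orderFun, rcomp_assoc]
    rw [this]
    refine Submodule.sum_mem _ fun r _ => ?_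
    by_cases hr : c r = 0
    · rw [hr, zero_smul]; exact zero_mem _
    · refine Submodule.smul_mem _ _ (Submodule.subset_span ⟨r, _, hc r hr, ?_, rfl⟩)
      conv_rhs => rw [← hs, transp_rcomp]
      rfl
  | zero =>
    have : pairFun c (0 : Set (X × α) → k) = 0 := by funext; simp [pairFun]
    rw [this]; exact zero_mem _
  | add g g' _ _ hg hg' => rw [pairFun_add]; exact add_mem hg hg'
  | smul a g _ hg => rw [pairFun_smul]; exact Submodule.smul_mem _ _ hg

theorem pairFun_zero_right (c : Set (α × X) → k) : pairFun c 0 = 0 := by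
  funext; simp [pairFun]

theorem pairFun_add_left (c d : Set (α × X) → k) (g : Set (X × α) → k) :
    pairFun (c + d) g = pairFun c g + pairFun d g := by
  funext Q; simp [pairFun, add_mul, Finset.sum_add_distrib]

theorem pairFun_smul_left (a : k) (c : Set (α × X) → k) (g : Set (X × α) → k) :
    pairFun (a • c) g = a • pairFun c g := by
  funext Q; simp [pairFun, mul_assoc, Finset.mul_sum]

theorem orderFun_mem_span_biFun {R : Set (α × α)} (hR : IsOrd R) {r : Set (α × X)}
    {l : Set (X × α)} (hr : R ⊚ r = r) (hl : l ⊚ R = l) :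
    orderFun k R r l ∈ Submodule.span k (Set.range (biFun k : BiWord α X → _)) := by
  classical
  have key : ∀ f ∈ Submodule.span k {f | ∃ φ : X → α ⊕ Set α, IsWord R φ ∧ f = wordFun k R φ},
      ∃ c : Set (α × X) → k, f = ∑ r, c r • leftFun k R r ∧
        ∀ g ∈ Submodule.span k
          {f | ∃ φ : X → α ⊕ Set α, IsWord (transp R) φ ∧ f = wordFun k (transp R) φ},
          pairFun c g ∈ Submodule.span k (Set.range (biFun k : BiWord α X → _)) := by
    intro f hf
    induction hf using Submodule.span_induction with
    | mem f hf =>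
      obtain ⟨φ, hφ, rfl⟩ := hf
      obtain ⟨c, -, hc⟩ := exists_coeff_of_mem_span (wordFun_mem_span (k := k) hR hφ)
      refine ⟨c, hc, fun g hg => ?_⟩
      induction hg using Submodule.span_induction with
      | mem g hg =>
        obtain ⟨ψ, hψ, rfl⟩ := hg
        exact Submodule.subset_span ⟨⟨R, φ, ψ, hR, hφ, hψ⟩, biFun_eq hc⟩
      | zero => rw [pairFun_zero_right]; exact zero_mem _
      | add g g' _ _ hg hg' => rw [pairFun_add]; exact add_mem hg hg'
      | smul a g _ hg => rw [pairFun_smul]; exact Submodule.smul_mem _ _ hg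
    | zero =>
      refine ⟨0, by simp, fun g _ => ?_⟩
      have : pairFun 0 g = 0 := by funext; simp [pairFun]
      rw [this]; exact zero_mem _
    | add f f' _ _ hf hf' =>
      obtain ⟨c, rfl, hc⟩ := hf
      obtain ⟨d, rfl, hd⟩ := hf'
      refine ⟨c + d, by simp [add_smul, Finset.sum_add_distrib], fun g hg => ?_⟩
      rw [pairFun_add_left]
      exact add_mem (hc g hg) (hd g hg)
    | smul a f _ hf =>
      obtain ⟨c, rfl, hc⟩ := hf
      refine ⟨a • c, by simp [Finset.smul_sum, mul_smul], fun g hg => ?_⟩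
      rw [pairFun_smul_left]
      exact Submodule.smul_mem _ _ (hc g hg)
  have h1 : leftFun k R r ∈ Submodule.span k
      {f | ∃ r : Set (α × X), R ⊚ r = r ∧ f = leftFun k R r} :=
    Submodule.subset_span ⟨r, hr, rfl⟩
  have h2 : leftFun k (transp R) (transp l) ∈ Submodule.span k
      {f | ∃ s : Set (α × X), transp R ⊚ s = s ∧ f = leftFun k (transp R) s} := by
    refine Submodule.subset_span ⟨_, ?_, rfl⟩
    rw [← transp_rcomp, hl]
  rw [span_leftFun' hR, wordSpan_strippedSets] at h1
  obtain ⟨c, hc, hcg⟩ := key _ h1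
  have h3 : ∑ r', (Pi.single r 1 : Set (α × X) → k) r' • leftFun k R r' = leftFun k R r := by
    rw [Finset.sum_eq_single r]
    · simp
    · intro b _ hb; rw [Pi.single_eq_of_ne hb, zero_smul]
    · simp
  have h4 : orderFun k R r l = pairFun c (leftFun k (transp R) (transp l)) := by
    rw [pairFun_congr (hc.symm.trans h3.symm) h2]
    funext Q
    rw [pairFun_leftFun, h3, leftFun, orderFun, rcomp_assoc]
    rfl
  rw [h4]
  apply hcg
  rw [← wordSpan_strippedSets, ← span_leftFun' hR.transp]
  exact h2

theorem biFun_rcomp_eq_zero {β : Type*} [Fintype β] (hβ : Fintype.card β < Fintype.card α)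
    (ω : BiWord α X) (l : Set (X × β)) (r : Set (β × X)) : biFun k ω (l ⊚ r) = 0 :=
  pairFun_rcomp_eq_zero hβ ω.isOrd _ (wordFun_mem_span ω.isOrd.transp ω.isWord_right) l r

theorem biFun_rcomp [DecidableEq α] (ω : BiWord α X) (l : Set (X × α)) (r : Set (α × X)) :
    biFun k ω (l ⊚ r) = ∑ σ : Perm α, wordFun k (σ • ω).rel (σ • ω).left l *
      wordFun k (transp (σ • ω).rel) (σ • ω).right (transp r) := by
  obtain ⟨c, hc, hcω⟩ := exists_biWord_coeff (k := k) ω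
  rw [biFun_eq hcω, pairFun_rcomp ω.isOrd hc
    (wordFun_mem_span ω.isOrd.transp ω.isWord_right), ← hcω, ← Equiv.sum_comp (Equiv.inv (Perm α))]
  refine Finset.sum_congr rfl fun σ _ => ?_
  have h : ∀ l : Set (X × α), relabel σ (relabel σ⁻¹ l) = l := relabel_relabel_inv σ
  rw [Equiv.inv_apply, BiWord.smul_rel, BiWord.smul_left, BiWord.smul_right, transp_smul]
  congr 1
  · conv_rhs => rw [← h l]
    rw [wordFun_smul]
  · conv_rhs => rw [← h (transp r)]
    rw [wordFun_smul]

end BiWord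

section Independence

open Equiv Pointwise

theorem wordFun_eq_zero_or_one {k α X : Type*} [Field k] (R : Set (α × α)) (φ : X → α ⊕ Set α)
    (l : Set (X × α)) : wordFun k R φ l = 0 ∨ wordFun k R φ l = 1 := by
  rw [wordFun]
  split_ifs <;> simp

variable {k X : Type*} [Field k] [Fintype X]

/-- The Boolean matrix on which the function of a pair of words is tested. -/
def BiWord.top {α : Type*} (ω : BiWord α X) : Set (X × α) × Set (X × α) :=
  (wordTop ω.rel ω.left, wordTop (transp ω.rel) ω.right)

theorem BiWord.top_injective {α : Type*} [Finite α] {ω ω' : BiWord α X} (h : ω.top = ω'.top) :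
    ω = ω' := by
  have h1 := wordTop_injective ω.isOrd ω'.isOrd ω.isWord_left ω'.isWord_left
    (congrArg Prod.fst h)
  have h2 := wordTop_injective ω.isOrd.transp ω'.isOrd.transp ω.isWord_right ω'.isWord_right
    (congrArg Prod.snd h)
  exact BiWord.ext h1.1 h1.2 h2.2

theorem exists_top_le_of_biFun_ne_zero {α : Type*} [Fintype α] {ω ω' : BiWord α X}
    (h : biFun k ω (ω'.top.1 ⊚ transp ω'.top.2) ≠ 0) : ∃ σ : Perm α, ω'.top ≤ (σ • ω).top := by
  classical
  rw [biFun_rcomp] at h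
  obtain ⟨σ, -, hσ⟩ := Finset.exists_ne_zero_of_sum_ne_zero h
  exact ⟨σ, subset_wordTop_of_wordFun_ne_zero (left_ne_zero_of_mul hσ),
    subset_wordTop_of_wordFun_ne_zero (right_ne_zero_of_mul hσ)⟩

theorem biFun_top_ne_zero [CharZero k] {α : Type*} [Fintype α] (ω : BiWord α X) :
    biFun k ω (ω.top.1 ⊚ transp ω.top.2) ≠ 0 := by
  classical
  rw [biFun_rcomp]
  have h : ∀ σ : Perm α, ∃ n : ℕ, wordFun k (σ • ω).rel (σ • ω).left ω.top.1 *
      wordFun k (transp (σ • ω).rel) (σ • ω).right (transp (transp ω.top.2)) = n := fun σ => by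
    rcases wordFun_eq_zero_or_one (k := k) (σ • ω).rel (σ • ω).left ω.top.1 with h1 | h1 <;>
    rcases wordFun_eq_zero_or_one (k := k) (transp (σ • ω).rel) (σ • ω).right
      (transp (transp ω.top.2)) with h2 | h2 <;> rw [h1, h2]
    exacts [⟨0, by simp⟩, ⟨0, by simp⟩, ⟨0, by simp⟩, ⟨1, by simp⟩]
  choose n hn using h
  simp only [hn]
  rw [← Nat.cast_sum, Nat.cast_ne_zero]
  have h1 : n 1 = 1 := by
    have := hn 1
    rw [one_smul] at this
    change wordFun k ω.rel ω.left (wordTop ω.rel ω.left) *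
      wordFun k (transp ω.rel) ω.right (wordTop (transp ω.rel) ω.right) = _ at this
    rw [wordFun_wordTop ω.isOrd ω.isWord_left, wordFun_wordTop ω.isOrd.transp ω.isWord_right,
      one_mul] at this
    exact_mod_cast this.symm
  have := Finset.single_le_sum (f := n) (fun _ _ => Nat.zero_le _) (Finset.mem_univ 1)
  omega

/-- The function attached to an orbit of pairs of words. -/
noncomputable def orbitFun (k : Type*) [Field k] {α : Type*} [Fintype α]
    (o : Quotient (MulAction.orbitRel (Perm α) (BiWord α X))) : Set (X × X) → k :=
  Quotient.lift (biFun k) (fun ω ω' h => by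
    obtain ⟨σ, rfl⟩ := MulAction.orbitRel_apply.1 h
    exact biFun_smul σ ω') o

variable (X) in
/-- Orbits of pairs of words for partial orders on less than `N` points. -/
abbrev OrbitIndex (N : ℕ) : Type _ :=
  (e : Fin N) × Quotient (MulAction.orbitRel (Perm (Fin e)) (BiWord (Fin e) X))

theorem linearIndependent_orbitFun [CharZero k] (N : ℕ) :
    LinearIndependent k (fun i : OrbitIndex X N => orbitFun k i.2) := by
  classical
  have := Fintype.ofFinite (OrbitIndex X N)
  rw [Fintype.linearIndependent_iff]
  intro g hg
  by_contra! hne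
  obtain ⟨i₀, hi₀⟩ := hne
  obtain ⟨⟨e, o⟩, hi, hmin⟩ := Finset.exists_minimalFor (fun i : OrbitIndex X N => i.1)
    (Finset.univ.filter fun i => g i ≠ 0) ⟨i₀, by simpa using hi₀⟩
  obtain ⟨ω₀, rfl⟩ := Quotient.exists_rep o
  obtain ⟨ω, hω, hmax⟩ := Set.Finite.exists_maximalFor
    (fun ω : BiWord (Fin e) X => ω.top) {ω | g ⟨e, Quotient.mk _ ω⟩ ≠ 0} (Set.toFinite _)
    ⟨ω₀, by simpa using hi⟩
  simp only [Set.mem_ofPred_eq] at hω hmax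
  have h0 := congrFun hg (ω.top.1 ⊚ transp ω.top.2)
  rw [Finset.sum_apply, Finset.sum_eq_single ⟨e, Quotient.mk _ ω⟩] at h0
  · rw [Pi.smul_apply, smul_eq_mul, Pi.zero_apply, mul_eq_zero] at h0
    exact h0.elim hω (biFun_top_ne_zero ω)
  · rintro ⟨e', o'⟩ - hne
    rw [Pi.smul_apply, smul_eq_mul, mul_eq_zero, or_iff_not_imp_left]
    intro hg'
    obtain ⟨ω', rfl⟩ := Quotient.exists_rep o'
    by_contra h
    have hle : e ≤ e' := by
      by_contra hlt
      have := hmin (j := ⟨e', Quotient.mk _ ω'⟩) (by simpa using hg') (not_le.1 hlt).le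
      exact hlt this
    rcases hle.lt_or_eq with hlt | rfl
    · exact h (biFun_rcomp_eq_zero (by simpa using hlt) ω' _ _)
    · obtain ⟨σ, hσ⟩ := exists_top_le_of_biFun_ne_zero h
      have hq : Quotient.mk (MulAction.orbitRel (Perm (Fin e)) (BiWord (Fin e) X)) (σ • ω') =
          Quotient.mk _ ω' := Quotient.sound (MulAction.mem_orbit _ _)
      have := BiWord.top_injective (le_antisymm hσ (hmax (j := σ • ω') (by rwa [hq]) hσ))
      rw [this, hq] at hne
      exact hne rfl
  · simp

theorem span_orbitFun :
    Submodule.span k (Set.range fun i : OrbitIndex X (Nat.card X + 1) => orbitFun k i.2) =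
      Submodule.span k (orderFuns k X) := by
  apply le_antisymm <;> rw [Submodule.span_le]
  · rintro _ ⟨⟨e, o⟩, rfl⟩
    obtain ⟨ω, rfl⟩ := Quotient.exists_rep o
    refine Submodule.span_mono ?_ (biFun_mem_span ω)
    rintro _ ⟨r, l, hr, hl, rfl⟩
    exact ⟨e, Nat.le_of_lt_succ e.2, ω.rel, r, l, ω.isOrd, hr, hl, rfl⟩
  · rintro _ ⟨n, hn, R, r, l, hR, hr, hl, rfl⟩
    refine Submodule.span_mono ?_ (orderFun_mem_span_biFun hR hr hl)
    rintro _ ⟨ω, rfl⟩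
    exact ⟨⟨⟨n, Nat.lt_succ_of_le hn⟩, Quotient.mk _ ω⟩, rfl⟩

theorem card_biWord_eq {α : Type*} [Fintype α] :
    Nat.card (BiWord α X) =
      Nat.card (Quotient (MulAction.orbitRel (Perm α) (BiWord α X))) *
        (Fintype.card α).factorial := by
  classical
  rw [Nat.card_congr (MulAction.selfEquivOrbitsQuotientProd BiWord.stabilizer_eq_bot),
    Nat.card_prod, Nat.card_eq_fintype_card (α := Perm α), Fintype.card_perm]

theorem finrank_span_orderFuns [CharZero k] :
    Module.finrank k (Submodule.span k (orderFuns k X)) =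
      ∑ e : Fin (Nat.card X + 1), Nat.card (BiWord (Fin e) X) / (e : ℕ).factorial := by
  classical
  have := Fintype.ofFinite (OrbitIndex X (Nat.card X + 1))
  rw [← span_orbitFun, finrank_span_eq_card (linearIndependent_orbitFun _),
    ← Nat.card_eq_fintype_card, Nat.card_sigma]
  refine Finset.sum_congr rfl fun e _ => ?_
  rw [card_biWord_eq, Fintype.card_fin, Nat.mul_div_cancel _ (Nat.factorial_pos _)]

end Independence

section WordCount

/-- The number of words of length `n` in `e + m` letters in which `e` given letters occur. -/
def wordCount (n e m : ℕ) : ℤ :=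
  ∑ i ∈ Finset.range (e + 1), (e.choose i) • ((-1) ^ i * ((e + m - i : ℕ) : ℤ) ^ n)

theorem card_words {X α β : Type*} [Finite X] [Finite α] [Finite β] :
    (Nat.card {φ : X → α ⊕ β // ∀ e, ∃ x, φ x = Sum.inl e} : ℤ) =
      wordCount (Nat.card X) (Nat.card α) (Nat.card β) := by
  classical
  have := Fintype.ofFinite X
  have := Fintype.ofFinite α
  have := Fintype.ofFinite β
  let S : α → Finset (X → α ⊕ β) := fun a => Finset.univ.filter fun φ => ∀ x, φ x ≠ Sum.inl a
  have h := Finset.inclusion_exclusion_card_inf_compl Finset.univ S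
  have h1 : Nat.card {φ : X → α ⊕ β // ∀ e, ∃ x, φ x = Sum.inl e} =
      (Finset.univ.inf fun a => (S a)ᶜ).card := by
    rw [Nat.card_eq_fintype_card, Fintype.card_subtype]
    congr 1
    ext φ
    simp [S, Finset.mem_inf]
  have h2 : ∀ t : Finset α, (t.inf S).card =
      (Fintype.card α + Fintype.card β - t.card) ^ Fintype.card X := fun t => by
    have : t.inf S = Fintype.piFinset fun _ : X =>
        (Finset.univ : Finset (α ⊕ β)) \ t.map Function.Embedding.inl := by
      ext φ
      simp only [Finset.mem_inf, S, Finset.mem_filter, Finset.mem_univ, true_and,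
        Fintype.mem_piFinset, Finset.mem_sdiff, Finset.mem_map, Function.Embedding.inl_apply,
        not_exists, not_and]
      exact ⟨fun h x a ha hx => h a ha x hx.symm, fun h a ha x hx => h x a ha hx.symm⟩
    rw [this, Fintype.card_piFinset, Finset.prod_const, Finset.card_univ, Finset.card_sdiff_of_subset (Finset.subset_univ _),
      Finset.card_map, Finset.card_univ, Fintype.card_sum]
  rw [h1, h]
  simp only [h2]
  rw [Finset.sum_powerset_apply_card
    (fun i => (-1 : ℤ) ^ i * (((Fintype.card α + Fintype.card β - i) ^ Fintype.card X : ℕ) : ℤ))]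
  simp [wordCount, Nat.card_eq_fintype_card]

variable {α X : Type*} [Finite α] [Finite X]

theorem card_isWord (R : Set (α × α)) :
    (Nat.card {φ : X → α ⊕ Set α // IsWord R φ} : ℤ) =
      wordCount (Nat.card X) (Nat.card α) (strippedSets R).ncard := by
  rw [← Nat.card_coe_set_eq, ← card_words]
  congr 1
  symm
  refine Nat.card_congr (Equiv.ofBijective (fun φ => ⟨fun x => Sum.map id Subtype.val (φ.1 x),
    ⟨fun x u hu => ?_, fun e => (φ.2 e).imp fun x hx => ?_⟩⟩) ⟨fun φ ψ h => ?_, fun φ => ?_⟩)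
  · rcases h : φ.1 x with a | v
    · rw [h] at hu; simp at hu
    · rw [h] at hu; simp only [Sum.map_inr, Sum.inr.injEq] at hu; exact hu ▸ v.2
  · rw [hx]; rfl
  · ext1
    funext x
    exact (Function.injective_id.sumMap Subtype.val_injective) (congrFun (congrArg Subtype.val h) x)
  · have h : ∀ x, ∃ a : α ⊕ strippedSets R, Sum.map id Subtype.val a = φ.1 x := fun x => by
      rcases h : φ.1 x with a | v
      · exact ⟨Sum.inl a, rfl⟩
      · exact ⟨Sum.inr ⟨v, φ.2.mem x v h⟩, rfl⟩
    choose f hf using h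
    refine ⟨⟨f, fun e => (φ.2.hits e).imp fun x hx => ?_⟩, ?_⟩
    · have := hf x
      rw [hx] at this
      rcases h : f x with a | v <;> rw [h] at this
      · simpa using this
      · simp at this
    · ext1
      funext x
      exact hf x

open Classical in
theorem card_biWord [Fintype α] : (Nat.card (BiWord α X) : ℤ) =
    ∑ R : Set (α × α), if IsOrd R then
      wordCount (Nat.card X) (Nat.card α) (strippedSets R).ncard *
      wordCount (Nat.card X) (Nat.card α) (strippedSets (transp R)).ncard else 0 := by
  have e : BiWord α X ≃ (R : {R : Set (α × α) // IsOrd R}) ×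
      ({φ : X → α ⊕ Set α // IsWord R.1 φ} × {φ : X → α ⊕ Set α // IsWord (transp R.1) φ}) :=
    { toFun := fun ω => ⟨⟨ω.rel, ω.isOrd⟩, ⟨ω.left, ω.isWord_left⟩, ⟨ω.right, ω.isWord_right⟩⟩
      invFun := fun p => ⟨p.1.1, p.2.1.1, p.2.2.1, p.1.2, p.2.1.2, p.2.2.2⟩
      left_inv := fun _ => rfl
      right_inv := fun _ => rfl }
  rw [Nat.card_congr e, Nat.card_sigma, ← Finset.sum_filter, Finset.sum_subtype (p := IsOrd)]
  · push_cast
    refine Finset.sum_congr rfl fun R _ => ?_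
    rw [Nat.card_prod, Nat.cast_mul, card_isWord, card_isWord]
  · simp

end WordCount

section Duality

variable {α : Type*} {R : Set (α × α)}

theorem subset_strip (_hR : IsOrd R) {u w : Set α} (hw : IsUp R w) (hne : ∀ e, w ≠ upSet R e)
    (h : w ⊆ u) : w ⊆ strip R u := by
  refine fun i hi => ⟨h hi, fun hu => hne i (Set.Subset.antisymm (hu ▸ h) fun j hj => hw i j hj hi)⟩

theorem subset_stripAll (hR : IsOrd R) {u w : Set α} (hw : IsUp R w) (hne : ∀ e, w ≠ upSet R e)
    (h : w ⊆ u) : w ⊆ stripAll R u := by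
  rw [stripAll]
  induction Nat.card α generalizing u with
  | zero => exact h
  | succ n ih => exact ih (subset_strip hR hw hne h)

theorem stripAll_subset (u : Set α) : stripAll R u ⊆ u := by
  rw [stripAll]
  induction Nat.card α generalizing u with
  | zero => exact subset_rfl
  | succ n ih => exact (ih _).trans (strip_subset u)

theorem exists_iterate_strip_eq (hR : IsOrd R) {v : Set α} (n : ℕ) {u w : Set α}
    (hu : (strip R)^[n] u = v) (hvw : v ⊆ w) (hwu : w ⊆ u) (hw : IsUp R w) :
    ∃ m, (strip R)^[m] w = v := by
  induction n generalizing u with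
  | zero => exact ⟨0, Set.Subset.antisymm (hwu.trans hu.le) hvw⟩
  | succ n ih =>
    by_cases hp : ∃ e, u = upSet R e
    · obtain ⟨e, rfl⟩ := hp
      by_cases he : e ∈ w
      · have : w = upSet R e := Set.Subset.antisymm hwu fun j hj => hw e j hj he
        exact ⟨n + 1, this ▸ hu⟩
      · refine ih hu ?_
        rw [strip_upSet hR]
        exact Set.subset_sdiff_singleton hwu he
    · push Not at hp
      rw [Function.iterate_succ_apply, strip_eq_self hp] at hu
      exact ih hu hwu

variable [Finite α]

theorem stripAll_eq_of_iterate {v w : Set α} (hv : strip R v = v) {m : ℕ}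
    (h : (strip R)^[m] w = v) : stripAll R w = v := by
  have h1 : stripAll R v = v := Function.iterate_fixed hv _
  have h2 : (strip R)^[m] (stripAll R w) = stripAll R w :=
    Function.iterate_fixed (strip_stripAll w) _
  rw [← h2, stripAll, ← Function.iterate_add_apply, add_comm, Function.iterate_add_apply, h]
  exact h1

theorem stripAll_ubSet_stripAll (hR : IsOrd R) {v : Set α} (hv : v ∈ strippedSets R) :
    stripAll R (ubSet R (stripAll (transp R) (ubSet (transp R) v))) = v := by
  obtain ⟨_, ⟨a, ha, hne, rfl⟩, rfl⟩ := id hv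
  set v := stripAll R (ubSet R a) with hvdef
  have hva : v ⊆ ubSet R a := stripAll_subset _
  have h1 : a ⊆ stripAll (transp R) (ubSet (transp R) v) := by
    refine subset_stripAll hR.transp (fun i j hij hi => ha j i hij hi) hne ?_
    exact fun i hi j hj => hva hj i hi
  obtain ⟨m, hm⟩ := exists_iterate_strip_eq hR (v := v)
    (w := ubSet R (stripAll (transp R) (ubSet (transp R) v))) _ hvdef.symm
    (fun j hj i hi => stripAll_subset _ hi j hj) (fun j hj i hi => hj i (h1 hi))
    (isUp_ubSet hR _)
  exact stripAll_eq_of_iterate (strip_stripAll _) hm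

theorem ncard_strippedSets_le (hR : IsOrd R) :
    (strippedSets R).ncard ≤ (strippedSets (transp R)).ncard := by
  refine Set.ncard_le_ncard_of_injOn (fun v => stripAll (transp R) (ubSet (transp R) v))
    (fun v hv => ?_) (fun v hv w hw h => ?_) (Set.toFinite _)
  · refine ⟨_, ⟨v, fun i j hij hj => isUp_of_mem_strippedSets hR hv j i hij hj, fun e he => ?_,
      rfl⟩, rfl⟩
    exact ne_upSet_of_mem_strippedSets hR hv e he
  · rw [← stripAll_ubSet_stripAll hR hv, ← stripAll_ubSet_stripAll hR hw]
    simp only at h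
    rw [h]

theorem ncard_strippedSets_transp (hR : IsOrd R) :
    (strippedSets (transp R)).ncard = (strippedSets R).ncard :=
  le_antisymm (ncard_strippedSets_le hR.transp) (ncard_strippedSets_le hR)

end Duality

section Reduction

open Classical in
/-- The sum over all partial orders `R` on `n` points of the squared numbers of words. -/
noncomputable def wordSqSum (N n : ℕ) : ℤ :=
  ∑ R : Set (Fin n × Fin n), if IsOrd R then wordCount N n (strippedSets R).ncard ^ 2 else 0

theorem finrank_jacobson_add_sum {k X : Type} [Field k] [CharZero k] [Fintype X] :
    (Module.finrank k (Submodule.restrictScalars k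
      (Ideal.jacobson (⊥ : Ideal (MonoidAlgebra k (Set (X × X)))))) : ℤ) +
      ∑ n ∈ Finset.range (Nat.card X + 1), wordSqSum (Nat.card X) n / (n.factorial : ℤ) =
      2 ^ (Nat.card X ^ 2) := by
  classical
  have h := finrank_jacobson_add_finrank_span (k := k) (M := Set (X × X)) _ (span_orderFuns k X)
  rw [finrank_span_orderFuns] at h
  have h1 : Nat.card (Set (X × X)) = 2 ^ (Nat.card X ^ 2) := by
    rw [Nat.card_eq_fintype_card, Fintype.card_set, Fintype.card_prod, sq,
      Nat.card_eq_fintype_card]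
  rw [h1, Finset.sum_fin_eq_sum_range] at h
  have h2 := congrArg (Nat.cast (R := ℤ)) h
  push_cast at h2
  rw [← h2, add_right_inj]
  refine Finset.sum_congr rfl fun n hn => ?_
  rw [dif_pos (Finset.mem_range.1 hn)]
  push_cast
  rw [card_biWord, wordSqSum]
  congr 1
  refine Finset.sum_congr rfl fun R _ => ?_
  split_ifs with hR
  · rw [ncard_strippedSets_transp hR, sq, Nat.card_eq_fintype_card (α := Fin n), Fintype.card_fin]
  · rfl

end Reduction

section Snoc

open Equiv Pointwise

/-- The elements strictly below `x`. -/
def sdown {α : Type*} (R : Set (α × α)) (x : α) : Set α := {y | (y, x) ∈ R ∧ y ≠ x}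

/-- The element `x` is maximal. -/
def IsMaxElt {α : Type*} (R : Set (α × α)) (x : α) : Prop := ∀ y, (x, y) ∈ R → y = x

/-- The maximal elements having the least number of elements below them. -/
def tops {α : Type*} (R : Set (α × α)) : Set α :=
  {x | IsMaxElt R x ∧ ∀ z, IsMaxElt R z → (sdown R x).ncard ≤ (sdown R z).ncard}

theorem tops_nonempty {α : Type*} [Finite α] [Nonempty α] {R : Set (α × α)} (hR : IsOrd R) :
    (tops R).Nonempty := by
  have hmax : {x | IsMaxElt R x}.Nonempty := by
    obtain ⟨x, hx⟩ := Finite.exists_min fun x => (upSet R x).ncard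
    refine ⟨x, fun y hxy => ?_⟩
    have h1 : upSet R y ⊆ upSet R x := fun z hz => hR.trans _ _ _ hxy hz
    have h2 : upSet R y = upSet R x := Set.eq_of_subset_of_ncard_le h1 (hx y) (Set.toFinite _)
    exact upSet_injective hR h2
  obtain ⟨x, hx, h⟩ := Set.exists_min_image {x | IsMaxElt R x} (fun x => (sdown R x).ncard)
    (Set.toFinite _) hmax
  exact ⟨x, hx, h⟩

theorem sdown_smul {α : Type*} (R : Set (α × α)) (σ : Perm α) (x : α) :
    sdown (σ • R) (σ x) = σ • sdown R x := by
  ext i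
  rw [mem_perm_smul']
  refine and_congr (mem_perm_smul.trans (by simp)) (not_congr ?_)
  exact Perm.inv_eq_iff_eq.symm.trans Iff.rfl

theorem isMaxElt_smul {α : Type*} {R : Set (α × α)} {σ : Perm α} {x : α} :
    IsMaxElt (σ • R) (σ x) ↔ IsMaxElt R x := by
  refine σ.symm.forall_congr fun y => ?_
  rw [mem_perm_smul]
  refine imp_congr (by simp) ?_
  exact (Equiv.symm_apply_eq σ).symm

theorem ncard_sdown_smul {α : Type*} (R : Set (α × α)) (σ : Perm α) (x : α) :
    (sdown (σ • R) (σ x)).ncard = (sdown R x).ncard := by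
  rw [sdown_smul]
  exact Set.ncard_image_of_injective _ (MulAction.injective σ)

theorem apply_mem_tops_smul {α : Type*} {R : Set (α × α)} {σ : Perm α} {x : α} :
    σ x ∈ tops (σ • R) ↔ x ∈ tops R := by
  refine and_congr isMaxElt_smul ?_
  refine σ.symm.forall_congr fun z => ?_
  have h : σ (σ.symm z) = z := σ.apply_symm_apply z
  rw [← ncard_sdown_smul R σ x, ← ncard_sdown_smul R σ (σ.symm z),
    ← isMaxElt_smul (R := R) (σ := σ) (x := σ.symm z), h]

theorem tops_smul {α : Type*} (R : Set (α × α)) (σ : Perm α) : tops (σ • R) = σ • tops R := by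
  ext x
  rw [mem_perm_smul', ← apply_mem_tops_smul (R := R) (σ := σ) (x := σ⁻¹ x)]
  exact iff_of_eq (congrArg (· ∈ tops (σ • R)) (σ.apply_symm_apply x).symm)

theorem ncard_tops_smul {α : Type*} (R : Set (α × α)) (σ : Perm α) :
    (tops (σ • R)).ncard = (tops R).ncard := by
  rw [tops_smul]
  exact Set.ncard_image_of_injective _ (MulAction.injective σ)

variable {n : ℕ}

/-- Add to the relation `Q` a last element with the elements of `A` below it. -/
def snoc (Q : Set (Fin n × Fin n)) (A : Set (Fin n)) : Set (Fin (n + 1) × Fin (n + 1)) :=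
  {p | (∃ i j, p = (Fin.castSucc i, Fin.castSucc j) ∧ (i, j) ∈ Q) ∨
    p.2 = Fin.last n ∧ ∀ i, p.1 = Fin.castSucc i → i ∈ A}

@[simp]
theorem castSucc_castSucc_mem_snoc {Q : Set (Fin n × Fin n)} {A : Set (Fin n)} {i j : Fin n} :
    (Fin.castSucc i, Fin.castSucc j) ∈ snoc Q A ↔ (i, j) ∈ Q := by
  simp [snoc, Fin.castSucc_ne_last]

@[simp]
theorem castSucc_last_mem_snoc {Q : Set (Fin n × Fin n)} {A : Set (Fin n)} {i : Fin n} :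
    (Fin.castSucc i, Fin.last n) ∈ snoc Q A ↔ i ∈ A := by
  simp [snoc, (Fin.castSucc_ne_last _).symm]

@[simp]
theorem last_castSucc_mem_snoc {Q : Set (Fin n × Fin n)} {A : Set (Fin n)} {j : Fin n} :
    (Fin.last n, Fin.castSucc j) ∈ snoc Q A ↔ False := by
  simp [snoc, Fin.castSucc_ne_last, (Fin.castSucc_ne_last _).symm]

@[simp]
theorem last_last_mem_snoc {Q : Set (Fin n × Fin n)} {A : Set (Fin n)} :
    (Fin.last n, Fin.last n) ∈ snoc Q A ↔ True := by
  simp [snoc, (Fin.castSucc_ne_last _).symm]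

theorem IsOrd.snoc {Q : Set (Fin n × Fin n)} {A : Set (Fin n)} (hQ : IsOrd Q) (hA : IsDown Q A) :
    IsOrd (snoc Q A) where
  refl i := by
    induction i using Fin.lastCases with
    | last => simp
    | cast i => simpa using hQ.refl i
  trans i j l h1 h2 := by
    induction i using Fin.lastCases <;> induction j using Fin.lastCases <;>
      induction l using Fin.lastCases <;> simp at h1 h2 ⊢
    · exact h1
    · exact hA _ _ h1 h2
    · exact hQ.trans _ _ _ h1 h2
  antisymm i j h1 h2 := by
    induction i using Fin.lastCases <;> induction j using Fin.lastCases <;> simp at h1 h2 ⊢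
    exact hQ.antisymm _ _ h1 h2

theorem isMaxElt_last_snoc (Q : Set (Fin n × Fin n)) (A : Set (Fin n)) :
    IsMaxElt (snoc Q A) (Fin.last n) := by
  intro y hy
  induction y using Fin.lastCases <;> simp at hy ⊢

open Classical in
theorem sum_isMaxElt_last {M : Type*} [AddCommMonoid M] (F : Set (Fin (n + 1) × Fin (n + 1)) → M) :
    ∑ P with IsOrd P ∧ IsMaxElt P (Fin.last n), F P =
      ∑ Q with IsOrd Q, ∑ A with IsDown Q A, F (snoc Q A) := by
  rw [Finset.sum_sigma']
  symm
  refine Finset.sum_nbij' (fun q => snoc q.1 q.2)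
    (fun P => ⟨{p | (Fin.castSucc p.1, Fin.castSucc p.2) ∈ P}, {i | (Fin.castSucc i, Fin.last n) ∈ P}⟩)
    ?_ ?_ ?_ ?_ ?_
  · rintro ⟨Q, A⟩ h
    simp only [Finset.mem_sigma, Finset.mem_filter, Finset.mem_univ, true_and] at h ⊢
    exact ⟨h.1.snoc h.2, isMaxElt_last_snoc Q A⟩
  · intro P h
    simp only [Finset.mem_sigma, Finset.mem_filter, Finset.mem_univ, true_and] at h ⊢
    refine ⟨⟨fun i => h.1.refl _, fun i j l => h.1.trans _ _ _, fun i j h1 h2 => ?_⟩,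
      fun i j => h.1.trans _ _ _⟩
    exact Fin.castSucc_injective _ (h.1.antisymm _ _ h1 h2)
  · rintro ⟨Q, A⟩ -
    simp
  · intro P h
    simp only [Finset.mem_filter, Finset.mem_univ, true_and] at h
    ext ⟨i, j⟩
    induction i using Fin.lastCases <;> induction j using Fin.lastCases <;> simp
    · exact h.1.refl _
    · exact fun h' => absurd (h.2 _ h') (Fin.castSucc_ne_last _)
  · intros; rfl

open Classical in
/-- The number of elements of `tops (snoc Q A)` if the last element is one of them, and otherwise
zero. -/
noncomputable def topCount (Q : Set (Fin n × Fin n)) (A : Set (Fin n)) : ℕ :=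
  if Fin.last n ∈ tops (snoc Q A) then (tops (snoc Q A)).ncard else 0

open Classical in
theorem mul_sum_isOrd (hn : n < 8) (H : Set (Fin (n + 1) × Fin (n + 1)) → ℕ)
    (hH : ∀ (σ : Perm (Fin (n + 1))) R, H (σ • R) = H R) :
    840 * ∑ R with IsOrd R, H R =
      ∑ Q with IsOrd Q, ∑ A with IsDown Q A, (n + 1) * (840 / topCount Q A) * H (snoc Q A) := by
  have hdiv : ∀ R : Set (Fin (n + 1) × Fin (n + 1)), IsOrd R →
      (tops R).ncard * (840 / (tops R).ncard) = 840 := fun R hR => by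
    have h1 : 0 < (tops R).ncard := (Set.ncard_pos (Set.toFinite _)).2 (tops_nonempty hR)
    have h2 : (tops R).ncard ≤ 8 := by
      have := Set.ncard_le_card (tops R)
      rw [Nat.card_eq_fintype_card, Fintype.card_fin] at this
      omega
    apply Nat.mul_div_cancel'
    interval_cases (tops R).ncard <;> norm_num
  have hcard : ∀ R : Set (Fin (n + 1) × Fin (n + 1)),
      (tops R).ncard = ∑ x, if x ∈ tops R then 1 else 0 := fun R => by
    rw [Finset.sum_boole, Set.ncard_eq_toFinset_card', Set.toFinset_card, Fintype.card_subtype]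
    rfl
  have hswap : ∀ x : Fin (n + 1),
      (∑ R with IsOrd R, if x ∈ tops R then 840 / (tops R).ncard * H R else 0) =
      ∑ R with IsOrd R, if Fin.last n ∈ tops R then 840 / (tops R).ncard * H R else 0 := fun x => by
    set σ : Perm (Fin (n + 1)) := swap x (Fin.last n)
    refine Finset.sum_nbij' (fun R => σ • R) (fun R => σ⁻¹ • R) ?_ ?_ ?_ ?_ ?_
    · intro R hR
      simp only [Finset.mem_filter, Finset.mem_univ, true_and] at hR ⊢
      exact hR.smul σ
    · intro R hR
      simp only [Finset.mem_filter, Finset.mem_univ, true_and] at hR ⊢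
      exact hR.smul _
    · intro R _; exact inv_smul_smul σ R
    · intro R _; exact smul_inv_smul σ R
    · intro R _
      have : Fin.last n = σ x := (swap_apply_left _ _).symm
      rw [hH, ncard_tops_smul, this, apply_mem_tops_smul]
  calc 840 * ∑ R with IsOrd R, H R
      = ∑ R with IsOrd R, ∑ x, if x ∈ tops R then 840 / (tops R).ncard * H R else 0 := by
        rw [Finset.mul_sum]
        refine Finset.sum_congr rfl fun R hR => ?_
        rw [Finset.mem_filter] at hR
        rw [← hdiv R hR.2]
        nth_rw 1 [hcard R]
        rw [mul_assoc, Finset.sum_mul]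
        refine Finset.sum_congr rfl fun x _ => ?_
        rw [ite_mul, one_mul, zero_mul, hdiv R hR.2]
    _ = (n + 1) * ∑ R with IsOrd R,
          if Fin.last n ∈ tops R then 840 / (tops R).ncard * H R else 0 := by
        rw [Finset.sum_comm, Finset.sum_congr rfl fun x _ => hswap x, Finset.sum_const,
          Finset.card_univ, Fintype.card_fin, smul_eq_mul]
    _ = (n + 1) * ∑ R with IsOrd R ∧ IsMaxElt R (Fin.last n),
          if Fin.last n ∈ tops R then 840 / (tops R).ncard * H R else 0 := by
        congr 1
        symm
        refine Finset.sum_subset (fun R hR => ?_) fun R hR hR' => ?_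
        · simp only [Finset.mem_filter, Finset.mem_univ, true_and] at hR ⊢
          exact hR.1
        · simp only [Finset.mem_filter, Finset.mem_univ, true_and] at hR hR'
          exact if_neg fun h => hR' ⟨hR, h.1⟩
    _ = _ := by
        rw [sum_isMaxElt_last, Finset.mul_sum]
        refine Finset.sum_congr rfl fun Q _ => ?_
        rw [Finset.mul_sum]
        refine Finset.sum_congr rfl fun A _ => ?_
        rw [topCount]
        split_ifs with h
        · rw [mul_assoc]
        · simp

/-- Extend a permutation by fixing the last element. -/
def extendPerm (σ : Perm (Fin n)) : Perm (Fin (n + 1)) :=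
  finSuccEquivLast.trans ((Equiv.optionCongr σ).trans finSuccEquivLast.symm)

@[simp]
theorem extendPerm_castSucc (σ : Perm (Fin n)) (i : Fin n) :
    extendPerm σ (Fin.castSucc i) = Fin.castSucc (σ i) := by
  simp [extendPerm]

@[simp]
theorem extendPerm_last (σ : Perm (Fin n)) : extendPerm σ (Fin.last n) = Fin.last n := by
  simp [extendPerm]

theorem snoc_smul (σ : Perm (Fin n)) (Q : Set (Fin n × Fin n)) (A : Set (Fin n)) :
    snoc (σ • Q) (σ • A) = extendPerm σ • snoc Q A := by
  have hinv : ∀ i, (extendPerm σ)⁻¹ (Fin.castSucc i) = Fin.castSucc (σ⁻¹ i) := fun i => by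
    rw [Perm.inv_eq_iff_eq, extendPerm_castSucc]
    exact congrArg _ (σ.apply_symm_apply i).symm
  have hlast : (extendPerm σ)⁻¹ (Fin.last n) = Fin.last n := by
    rw [Perm.inv_eq_iff_eq, extendPerm_last]
  ext ⟨i, j⟩
  rw [mem_perm_smul]
  induction i using Fin.lastCases <;> induction j using Fin.lastCases <;>
    simp only [hinv, hlast, castSucc_castSucc_mem_snoc, castSucc_last_mem_snoc,
      last_castSucc_mem_snoc, last_last_mem_snoc]
  · exact mem_perm_smul'
  · exact mem_perm_smul

theorem topCount_smul (σ : Perm (Fin n)) (Q : Set (Fin n × Fin n)) (A : Set (Fin n)) :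
    topCount (σ • Q) (σ • A) = topCount Q A := by
  have := apply_mem_tops_smul (R := snoc Q A) (σ := extendPerm σ) (x := Fin.last n)
  rw [extendPerm_last] at this
  classical
  rw [topCount, topCount, snoc_smul, ncard_tops_smul]
  exact if_congr this rfl rfl

open Classical in
/-- The weighted sum of `H` over the `k`-fold extensions of `Q`. -/
noncomputable def extSum (H : ∀ n, Set (Fin n × Fin n) → ℕ) :
    ℕ → ∀ n, Set (Fin n × Fin n) → ℕ
  | 0, n, Q => H n Q
  | k + 1, n, Q =>
    ∑ A with IsDown Q A, (n + 1) * (840 / topCount Q A) * extSum H k (n + 1) (snoc Q A)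

theorem extSum_smul {H : ∀ n, Set (Fin n × Fin n) → ℕ}
    (hH : ∀ n (σ : Perm (Fin n)) R, H n (σ • R) = H n R) (k : ℕ) (n : ℕ) (σ : Perm (Fin n))
    (Q : Set (Fin n × Fin n)) : extSum H k n (σ • Q) = extSum H k n Q := by
  classical
  induction k generalizing n with
  | zero => exact hH n σ Q
  | succ k ih =>
    rw [extSum, extSum]
    symm
    refine Finset.sum_nbij' (fun A => σ • A) (fun A => σ⁻¹ • A) ?_ ?_ ?_ ?_ ?_
    · intro A hA
      simp only [Finset.mem_filter, Finset.mem_univ, true_and] at hA ⊢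
      exact hA.smul σ
    · intro A hA
      simp only [Finset.mem_filter, Finset.mem_univ, true_and] at hA ⊢
      have := hA.smul σ⁻¹
      rwa [inv_smul_smul] at this
    · intro A _; exact inv_smul_smul σ A
    · intro A _; exact smul_inv_smul σ A
    · intro A _
      rw [topCount_smul, snoc_smul, ih]

open Classical in
theorem sum_extSum {H : ∀ n, Set (Fin n × Fin n) → ℕ}
    (hH : ∀ n (σ : Perm (Fin n)) R, H n (σ • R) = H n R) (k n m : ℕ) (hm : n + k = m)
    (hm8 : m ≤ 8) :
    ∑ Q with IsOrd Q, extSum H k n Q = 840 ^ k * ∑ R with IsOrd R, H m R := by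
  induction k generalizing n with
  | zero =>
    obtain rfl : n = m := hm
    simp [extSum]
  | succ k ih =>
    simp only [extSum]
    rw [← mul_sum_isOrd (by omega) _ (extSum_smul hH k (n + 1)), ih (n + 1) (by omega), pow_succ]
    ring

end Snoc

section Mask

variable {n : ℕ}

open Classical in
/-- The natural number whose binary digits are given by `s`. -/
noncomputable def mask (s : Set (Fin n)) : ℕ := Nat.ofBits fun i => decide (i ∈ s)

theorem testBit_mask (s : Set (Fin n)) (j : ℕ) :
    (mask s).testBit j = true ↔ ∃ h : j < n, (⟨j, h⟩ : Fin n) ∈ s := by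
  by_cases h : j < n
  · simp [mask, Nat.testBit_ofBits_lt _ _ h, h]
  · simp [mask, Nat.testBit_ofBits_ge _ _ (not_lt.1 h), h]

theorem mask_injective : Function.Injective (mask (n := n)) := fun s t h => by
  ext i
  have := testBit_mask s i
  rw [h, testBit_mask] at this
  simpa using this.symm

theorem eq_mask {m : ℕ} {s : Set (Fin n)}
    (h : ∀ j, m.testBit j = true ↔ ∃ h : j < n, (⟨j, h⟩ : Fin n) ∈ s) : m = mask s :=
  Nat.eq_of_testBit_eq fun j => Bool.eq_iff_iff.2 ((h j).trans (testBit_mask s j).symm)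

theorem land_mask (s t : Set (Fin n)) : Nat.land (mask s) (mask t) = mask (s ∩ t) := by
  apply eq_mask
  intro j
  change (mask s &&& mask t).testBit j = true ↔ _
  rw [Nat.testBit_and, Bool.and_eq_true, testBit_mask, testBit_mask]
  exact ⟨fun ⟨⟨h, h1⟩, ⟨_, h2⟩⟩ => ⟨h, h1, h2⟩, fun ⟨h, h1, h2⟩ => ⟨⟨h, h1⟩, ⟨h, h2⟩⟩⟩

@[simp]
theorem mask_empty : mask (∅ : Set (Fin n)) = 0 := by
  symm
  apply eq_mask
  simp

theorem mask_singleton (i : Fin n) : mask {i} = 2 ^ (i : ℕ) := by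
  symm
  apply eq_mask
  intro j
  rw [Nat.testBit_two_pow, decide_eq_true_iff]
  constructor
  · rintro rfl
    exact ⟨i.2, rfl⟩
  · rintro ⟨h, rfl⟩
    rfl

theorem mask_castSucc (s : Set (Fin n)) : mask (Fin.castSucc '' s) = mask s := by
  symm
  apply eq_mask
  intro j
  rw [testBit_mask]
  constructor
  · rintro ⟨h, hs⟩
    exact ⟨by omega, _, hs, rfl⟩
  · rintro ⟨h, i, hs, hi⟩
    obtain rfl : (i : ℕ) = j := congrArg Fin.val hi
    exact ⟨i.2, hs⟩

theorem mask_insert_last (s : Set (Fin n)) :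
    mask (insert (Fin.last n) (Fin.castSucc '' s)) = Nat.lor (mask s) (2 ^ n) := by
  symm
  apply eq_mask
  intro j
  change (mask s ||| 2 ^ n).testBit j = true ↔ _
  rw [← mask_castSucc, Nat.testBit_or, Bool.or_eq_true, testBit_mask, Nat.testBit_two_pow,
    decide_eq_true_iff]
  constructor
  · rintro (⟨h, hs⟩ | rfl)
    · exact ⟨h, Or.inr hs⟩
    · exact ⟨by omega, Or.inl rfl⟩
  · rintro ⟨h, hs | hs⟩
    · exact Or.inr (congrArg Fin.val hs).symm
    · exact Or.inl ⟨h, hs⟩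

theorem mask_singleton_last : mask {Fin.last n} = 2 ^ n := mask_singleton _

theorem xor_mask {u : Set (Fin n)} {i : Fin n} (hi : i ∈ u) :
    Nat.xor (mask u) (2 ^ (i : ℕ)) = mask (u \ {i}) := by
  apply eq_mask
  intro j
  change (mask u ^^^ 2 ^ (i : ℕ)).testBit j = true ↔ _
  rw [Nat.testBit_xor, Nat.testBit_two_pow]
  by_cases h : (i : ℕ) = j
  · subst h
    simp [testBit_mask, hi]
  · simp [testBit_mask, h, Fin.ext_iff, Ne.symm h]

theorem beq_mask (s t : Set (Fin n)) : Nat.beq (mask s) (mask t) = true ↔ s = t := by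
  rw [Nat.beq_eq, mask_injective.eq_iff]

theorem beq_land_mask_left (s t : Set (Fin n)) :
    Nat.beq (Nat.land (mask s) (mask t)) (mask s) = true ↔ s ⊆ t := by
  rw [land_mask, beq_mask, Set.inter_eq_left]

theorem beq_land_mask_right (s t : Set (Fin n)) :
    Nat.beq (Nat.land (mask s) (mask t)) (mask t) = true ↔ t ⊆ s := by
  rw [land_mask, beq_mask, Set.inter_eq_right]

theorem beq_land_mask_zero (s t : Set (Fin n)) :
    Nat.beq (Nat.land (mask s) (mask t)) 0 = true ↔ s ∩ t = ∅ := by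
  rw [land_mask, ← mask_empty (n := n), beq_mask]

/-- The binary digits of `F` give the family `S`, which has `c` elements. -/
structure IsFam (F c : ℕ) (S : Set (Set (Fin n))) : Prop where
  testBit : ∀ w, F.testBit (mask w) = true ↔ w ∈ S
  ncard : S.ncard = c

theorem isFam_empty : IsFam 0 0 (∅ : Set (Set (Fin n))) := ⟨by simp, by simp⟩

theorem IsFam.insert {F c : ℕ} {S : Set (Set (Fin n))} (h : IsFam F c S) {v : Set (Fin n)}
    (hv : v ∉ S) : IsFam (Nat.lor F (Nat.shiftLeft 1 (mask v))) (Nat.succ c) (insert v S) where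
  testBit w := by
    change (F ||| 1 <<< mask v).testBit (mask w) = true ↔ _
    rw [Nat.one_shiftLeft, Nat.testBit_or, Bool.or_eq_true, h.testBit, Nat.testBit_two_pow,
      decide_eq_true_iff, mask_injective.eq_iff, Set.mem_insert_iff, or_comm, @eq_comm _ v w]
  ncard := by rw [Set.ncard_insert_of_notMem hv, h.ncard]

theorem IsFam.erase {F c : ℕ} {S : Set (Set (Fin n))} (h : IsFam F c S) {v : Set (Fin n)}
    (hv : v ∈ S) : IsFam (Nat.xor F (Nat.shiftLeft 1 (mask v))) (Nat.pred c) (S \ {v}) where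
  testBit w := by
    change (F ^^^ 1 <<< mask v).testBit (mask w) = true ↔ _
    rw [Nat.one_shiftLeft, Nat.testBit_xor, Nat.testBit_two_pow]
    by_cases hw : w = v
    · subst hw
      simp [(h.testBit w).2 hv]
    · have : mask v ≠ mask w := fun h' => hw (mask_injective h').symm
      simp [this, h.testBit, hw]
  ncard := by rw [Set.ncard_sdiff_singleton_of_mem hv, h.ncard]; rfl

theorem IsFam.beq {F c : ℕ} {S : Set (Set (Fin n))} (h : IsFam F c S) (v : Set (Fin n)) :
    Nat.beq (Nat.land 1 (Nat.shiftRight F (mask v))) 0 = true ↔ v ∉ S := by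
  rw [← h.testBit v, Nat.beq_eq, Nat.testBit, bne_iff_ne, not_not]
  rfl

end Mask

/-- Lists of triples of natural numbers. -/
inductive ML
  | nil
  | cons (a v s : ℕ) (r : ML)

namespace ML

/-- The list of the triples `(f i, g i, h i)`. -/
def mk {α : Type*} (f g h : α → ℕ) : List α → ML
  | [] => nil
  | i :: l => cons (f i) (g i) (h i) (mk f g h l)

/-- For a list of pairs `(a, v)` of sets, add those `v` with `a` and `v` disjoint to the family
`F` with `c` elements. -/
noncomputable def fam (D : ML) : ℕ → ℕ → (ℕ → ℕ → ℕ) → ℕ :=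
  ML.rec (fun F c k => k F c) (fun a v _ _ ih F c k =>
    cond (Nat.beq (Nat.land a v) 0)
      (cond (Nat.beq (Nat.land 1 (Nat.shiftRight F v)) 0)
        (ih (Nat.lor F (Nat.shiftLeft 1 v)) (Nat.succ c) k) (ih F c k))
      (ih F c k)) D

/-- For a list of pairs `(p, u)` of a point and a set, replace each `u` in the family `F` by its
symmetric difference with `p`, and return the number of elements at the end. -/
noncomputable def stripF (T : ML) : ℕ → ℕ → ℕ :=
  ML.rec (fun _ c => c) (fun p u _ _ ih F c =>
    cond (Nat.beq (Nat.land 1 (Nat.shiftRight F u)) 0) (ih F c)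
      (cond (Nat.beq (Nat.land 1 (Nat.shiftRight F (Nat.xor u p))) 0)
        (ih (Nat.lor (Nat.xor F (Nat.shiftLeft 1 u)) (Nat.shiftLeft 1 (Nat.xor u p)))
          (Nat.succ (Nat.pred c)))
        (ih (Nat.xor F (Nat.shiftLeft 1 u)) (Nat.pred c)))) T

/-- The number of stripped sets. -/
noncomputable def mc (D T : ML) : ℕ := fam D 0 0 (stripF T)

end ML

section StripCount

variable {n : ℕ} {R : Set (Fin n × Fin n)}

/-- The lower sets in `L`, with their upper bounds and their sizes. -/
noncomputable def downML (R : Set (Fin n × Fin n)) (L : List (Set (Fin n))) : ML :=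
  ML.mk mask (fun s => mask (ubSet R s)) Set.ncard L

/-- The points in `l`, with the sets above them and the number of points strictly below them. -/
noncomputable def upML (R : Set (Fin n × Fin n)) (l : List (Fin n)) : ML :=
  ML.mk (fun i : Fin n => 2 ^ (i : ℕ)) (fun i => mask (upSet R i)) (fun i => (sdown R i).ncard) l

theorem fam_downML (L : List (Set (Fin n))) {F c : ℕ} {S : Set (Set (Fin n))} (h : IsFam F c S)
    (k : ℕ → ℕ → ℕ) : ∃ F' c', IsFam F' c' (S ∪ ubSet R '' {s | s ∈ L ∧ s ∩ ubSet R s = ∅}) ∧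
      (downML R L).fam F c k = k F' c' := by
  induction L generalizing F c S with
  | nil => exact ⟨F, c, by simpa using h, rfl⟩
  | cons s L ih =>
    have step : (downML R (s :: L)).fam F c k =
        cond (Nat.beq (Nat.land (mask s) (mask (ubSet R s))) 0)
          (cond (Nat.beq (Nat.land 1 (Nat.shiftRight F (mask (ubSet R s)))) 0)
            ((downML R L).fam (Nat.lor F (Nat.shiftLeft 1 (mask (ubSet R s)))) (Nat.succ c) k)
            ((downML R L).fam F c k))
          ((downML R L).fam F c k) := rfl
    rw [step]
    by_cases h1 : s ∩ ubSet R s = ∅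
    · have hS : {t | t ∈ s :: L ∧ t ∩ ubSet R t = ∅} =
          insert s {t | t ∈ L ∧ t ∩ ubSet R t = ∅} := by
        ext t
        simp only [List.mem_cons, Set.mem_ofPred_eq, Set.mem_insert_iff, or_and_right]
        exact or_congr_left (and_iff_left_of_imp (by rintro rfl; exact h1))
      rw [(beq_land_mask_zero _ _).2 h1, cond_true, hS, Set.image_insert_eq,
        Set.union_insert, ← Set.insert_union]
      by_cases h2 : ubSet R s ∈ S
      · rw [Bool.eq_false_iff.2 (mt (h.beq _).1 (not_not.2 h2)), cond_false,
          Set.insert_eq_of_mem h2]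
        exact ih h
      · rw [(h.beq _).2 h2, cond_true]
        exact ih (h.insert h2)
    · have hS : {t | t ∈ s :: L ∧ t ∩ ubSet R t = ∅} = {t | t ∈ L ∧ t ∩ ubSet R t = ∅} := by
        ext t
        simp only [List.mem_cons, Set.mem_ofPred_eq, or_and_right]
        exact or_iff_right (by rintro ⟨rfl, h⟩; exact h1 h)
      rw [Bool.eq_false_iff.2 (mt (beq_land_mask_zero _ _).1 h1), cond_false, hS]
      exact ih h

open Classical in
/-- Remove `i` from `x` if `x` is the upper set generated by `i`. -/
noncomputable def stripAt (R : Set (Fin n × Fin n)) (x : Set (Fin n)) (i : Fin n) : Set (Fin n) :=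
  if x = upSet R i then x \ {i} else x

theorem stripF_upML (hR : IsOrd R) (l : List (Fin n)) {F c : ℕ} {S : Set (Set (Fin n))}
    (h : IsFam F c S) :
    (upML R l).stripF F c = ((fun x => l.foldl (stripAt R) x) '' S).ncard := by
  induction l generalizing F c S with
  | nil =>
    change c = _
    simpa using h.ncard.symm
  | cons i l ih =>
    have hi : i ∈ upSet R i := hR.refl i
    have step : (upML R (i :: l)).stripF F c =
        cond (Nat.beq (Nat.land 1 (Nat.shiftRight F (mask (upSet R i)))) 0)
          ((upML R l).stripF F c)
          (cond (Nat.beq (Nat.land 1 (Nat.shiftRight F (Nat.xor (mask (upSet R i)) (2 ^ (i : ℕ))))) 0)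
            ((upML R l).stripF (Nat.lor (Nat.xor F (Nat.shiftLeft 1 (mask (upSet R i))))
              (Nat.shiftLeft 1 (Nat.xor (mask (upSet R i)) (2 ^ (i : ℕ))))) (Nat.succ (Nat.pred c)))
            ((upML R l).stripF (Nat.xor F (Nat.shiftLeft 1 (mask (upSet R i)))) (Nat.pred c))) := rfl
    have himg : (fun x => (i :: l).foldl (stripAt R) x) '' S =
        (fun x => l.foldl (stripAt R) x) '' ((fun x => stripAt R x i) '' S) := by
      rw [Set.image_image]; rfl
    rw [step, xor_mask hi, himg]
    have hne : upSet R i \ {i} ≠ upSet R i := fun h' =>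
      (h'.symm.subset hi).2 rfl
    by_cases h1 : upSet R i ∈ S
    · have hS : (fun x => stripAt R x i) '' S = insert (upSet R i \ {i}) (S \ {upSet R i}) := by
        ext x
        simp only [Set.mem_image, Set.mem_insert_iff, Set.mem_sdiff, Set.mem_singleton_iff]
        constructor
        · rintro ⟨y, hy, rfl⟩
          by_cases hyi : y = upSet R i
          · exact Or.inl (by rw [stripAt, if_pos hyi, hyi])
          · exact Or.inr (by rw [stripAt, if_neg hyi]; exact ⟨hy, hyi⟩)
        · rintro (rfl | ⟨hx, hxi⟩)
          · exact ⟨_, h1, if_pos rfl⟩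
          · exact ⟨x, hx, if_neg hxi⟩
      rw [Bool.eq_false_iff.2 (mt (h.beq _).1 (not_not.2 h1)), cond_false, hS]
      by_cases h2 : upSet R i \ {i} ∈ S
      · rw [Bool.eq_false_iff.2 (mt (h.beq _).1 (not_not.2 h2)), cond_false,
          Set.insert_eq_of_mem (show _ ∈ S \ {upSet R i} from ⟨h2, hne⟩)]
        exact ih (h.erase h1)
      · rw [(h.beq _).2 h2, cond_true]
        exact ih ((h.erase h1).insert fun h' => h2 h'.1)
    · have hS : (fun x => stripAt R x i) '' S = S := by
        rw [Set.image_congr (g := id), Set.image_id]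
        exact fun x hx => if_neg (c := x = upSet R i) fun h' => h1 (h' ▸ hx)
      rw [(h.beq _).2 h1, cond_true, hS]
      exact ih h

theorem exists_iterate_foldl_stripAt (hR : IsOrd R) (l : List (Fin n)) (x : Set (Fin n)) :
    ∃ m, (strip R)^[m] x = l.foldl (stripAt R) x := by
  induction l generalizing x with
  | nil => exact ⟨0, rfl⟩
  | cons i l ih =>
    obtain ⟨m, hm⟩ := ih (stripAt R x i)
    by_cases h : x = upSet R i
    · refine ⟨m + 1, ?_⟩
      have : strip R x = stripAt R x i := by rw [stripAt, if_pos h, h, strip_upSet hR]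
      rw [Function.iterate_succ_apply, this, hm, List.foldl_cons]
    · refine ⟨m, ?_⟩
      rw [List.foldl_cons, ← hm, stripAt, if_neg h]

theorem foldl_stripAt_ne (hnat : ∀ i j, (i, j) ∈ R → i ≤ j) (l : List (Fin n))
    (hl : l.Pairwise (· < ·)) (hcl : ∀ i ∈ l, ∀ j, i < j → j ∈ l) (x : Set (Fin n))
    (hx : ∀ j ∉ l, x ≠ upSet R j) (hR : IsOrd R) (j : Fin n) :
    l.foldl (stripAt R) x ≠ upSet R j := by
  induction l generalizing x with
  | nil => exact hx j (by simp)
  | cons i l ih =>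
    rw [List.pairwise_cons] at hl
    rw [List.foldl_cons]
    refine ih hl.2 (fun a ha b hab => ?_) _ fun b hb => ?_
    · have := hcl a (List.mem_cons_of_mem _ ha) b hab
      exact (List.mem_cons.1 this).resolve_left ((hl.1 a ha).trans hab).ne'
    · by_cases h : x = upSet R i
      · rw [stripAt, if_pos h, h]
        intro hib
        have hb' : b ∈ upSet R i \ {i} := hib ▸ hR.refl b
        have hlt : i < b := lt_of_le_of_ne (hnat _ _ hb'.1) (Ne.symm hb'.2)
        exact hb ((List.mem_cons.1 (hcl i List.mem_cons_self b hlt)).resolve_left hlt.ne')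
      · rw [stripAt, if_neg h]
        by_cases hbi : b = i
        · rwa [hbi]
        · exact hx b (by simp [hbi, hb])

theorem foldl_stripAt_eq_stripAll (hR : IsOrd R) (hnat : ∀ i j, (i, j) ∈ R → i ≤ j)
    (x : Set (Fin n)) : (List.finRange n).foldl (stripAt R) x = stripAll R x := by
  obtain ⟨m, hm⟩ := exists_iterate_foldl_stripAt hR (List.finRange n) x
  refine (stripAll_eq_of_iterate ((strip_eq_self_iff hR).2 ?_) hm).symm
  exact foldl_stripAt_ne hnat _ (List.pairwise_lt_finRange n) (fun _ _ _ _ => List.mem_finRange _) _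
    (fun j hj => absurd (List.mem_finRange j) hj) hR

theorem ubSets_eq (hR : IsOrd R) :
    ubSets R = ubSet R '' {s | IsDown R s ∧ s ∩ ubSet R s = ∅} := by
  have key : ∀ s, IsDown R s → ((∀ e, s ≠ downSet R e) ↔ s ∩ ubSet R s = ∅) := fun s hs => by
    rw [← not_iff_not, ← Ne, ← Set.nonempty_iff_ne_empty]
    push Not
    constructor
    · rintro ⟨e, rfl⟩
      exact ⟨e, hR.refl e, fun i hi => hi⟩
    · rintro ⟨e, he, he'⟩
      exact ⟨e, Set.Subset.antisymm he' fun i hi => hs i e hi he⟩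
  ext u
  constructor
  · rintro ⟨a, h1, h2, rfl⟩
    exact ⟨a, ⟨h1, (key a h1).1 h2⟩, rfl⟩
  · rintro ⟨a, ⟨h1, h2⟩, rfl⟩
    exact ⟨a, h1, (key a h1).2 h2, rfl⟩

theorem mc_eq_ncard_strippedSets (hR : IsOrd R) (hnat : ∀ i j, (i, j) ∈ R → i ≤ j)
    {L : List (Set (Fin n))} (hL : ∀ s, s ∈ L ↔ IsDown R s) :
    (downML R L).mc (upML R (List.finRange n)) = (strippedSets R).ncard := by
  obtain ⟨F, c, h1, h2⟩ := fam_downML (R := R) L isFam_empty ((upML R (List.finRange n)).stripF)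
  rw [ML.mc, h2, stripF_upML hR _ h1, strippedSets, ubSets_eq hR, Set.empty_union]
  simp only [foldl_stripAt_eq_stripAll hR hnat, hL]

end StripCount

namespace ML

/-- Extend the list of lower sets by those containing a new point `P` placed above `d`. -/
noncomputable def ext (d P : ℕ) (D : ML) : ML :=
  ML.rec nil (fun a v s _ ih =>
    cond (Nat.beq (Nat.land a d) a)
      (cond (Nat.beq (Nat.land a d) d)
        (cons a (Nat.lor v P) s (cons (Nat.lor a P) P (Nat.succ s) ih))
        (cons a (Nat.lor v P) s ih))
      (cond (Nat.beq (Nat.land a d) d)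
        (cons a v s (cons (Nat.lor a P) 0 (Nat.succ s) ih)) (cons a v s ih))) D

/-- Add to the list of points a new point `P` placed above the `t` points of `d`. -/
noncomputable def extT (d P t : ℕ) (T : ML) : ML :=
  ML.rec (cons P P t nil) (fun p u s _ ih =>
    cons p (cond (Nat.beq (Nat.land d p) 0) u (Nat.lor u P)) s ih) T

/-- Add to `c` the number of maximal points outside `a` having exactly `t` points below them; the
result is zero if one of them has fewer points below it. -/
noncomputable def cnt (a t : ℕ) (T : ML) : ℕ → ℕ :=
  ML.rec (fun c => c) (fun p u s _ ih c =>
    cond (Nat.beq u p)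
      (cond (Nat.beq (Nat.land a p) 0)
        (cond (Nat.ble t s) (cond (Nat.beq s t) (ih (Nat.succ c)) (ih c)) 0) (ih c))
      (ih c)) T

/-- The weighted sum of `leaf` over the `k`-fold extensions. -/
noncomputable def dfs (leaf : ML → ML → ℕ) (k : ℕ) : ℕ → ℕ → ML → ML → ℕ → ℕ :=
  Nat.rec (fun _ _ D T w => Nat.mul w (leaf D T)) (fun _ ih N P D T w =>
    ML.rec 0 (fun a _ s _ r =>
      cond (Nat.beq (cnt a s T 1) 0) r
        (Nat.add (ih (Nat.succ N) (Nat.mul 2 P) (ext a P D) (extT a P s T)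
          (Nat.mul (Nat.mul w (Nat.succ N)) (Nat.div 840 (cnt a s T 1)))) r)) D) k

end ML

section Enumeration

variable {n : ℕ} {Q : Set (Fin n × Fin n)} {A : Set (Fin n)}

theorem castSucc_mem_image {s : Set (Fin n)} {i : Fin n} :
    Fin.castSucc i ∈ Fin.castSucc '' s ↔ i ∈ s :=
  (Fin.castSucc_injective n).mem_set_image

theorem last_notMem_image (s : Set (Fin n)) : Fin.last n ∉ Fin.castSucc '' s := by
  rintro ⟨i, -, h⟩
  exact Fin.castSucc_ne_last i h

theorem ncard_castSucc (s : Set (Fin n)) : (Fin.castSucc '' s).ncard = s.ncard :=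
  Set.ncard_image_of_injective _ (Fin.castSucc_injective n)

theorem upSet_snoc_castSucc_of_mem {i : Fin n} (h : i ∈ A) :
    upSet (snoc Q A) (Fin.castSucc i) = insert (Fin.last n) (Fin.castSucc '' upSet Q i) := by
  ext j
  induction j using Fin.lastCases <;>
    simp [upSet, h, Fin.castSucc_ne_last]

theorem upSet_snoc_castSucc_of_notMem {i : Fin n} (h : i ∉ A) :
    upSet (snoc Q A) (Fin.castSucc i) = Fin.castSucc '' upSet Q i := by
  ext j
  induction j using Fin.lastCases <;>
    simp [upSet, h, Fin.castSucc_ne_last]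

theorem upSet_snoc_last : upSet (snoc Q A) (Fin.last n) = {Fin.last n} := by
  ext j
  induction j using Fin.lastCases <;> simp [upSet, Fin.castSucc_ne_last]

theorem sdown_snoc_castSucc (i : Fin n) :
    sdown (snoc Q A) (Fin.castSucc i) = Fin.castSucc '' sdown Q i := by
  ext j
  induction j using Fin.lastCases <;> simp [sdown, Fin.castSucc_ne_last]

theorem sdown_snoc_last : sdown (snoc Q A) (Fin.last n) = Fin.castSucc '' A := by
  ext j
  induction j using Fin.lastCases <;> simp [sdown, Fin.castSucc_ne_last]

theorem ubSet_snoc_of_subset {s : Set (Fin n)} (h : s ⊆ A) :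
    ubSet (snoc Q A) (Fin.castSucc '' s) = insert (Fin.last n) (Fin.castSucc '' ubSet Q s) := by
  ext j
  induction j using Fin.lastCases
  · simpa [ubSet, Set.subset_def] using h
  · simp [ubSet, Fin.castSucc_ne_last]

theorem ubSet_snoc_of_not_subset {s : Set (Fin n)} (h : ¬s ⊆ A) :
    ubSet (snoc Q A) (Fin.castSucc '' s) = Fin.castSucc '' ubSet Q s := by
  ext j
  induction j using Fin.lastCases
  · simpa [ubSet, Fin.castSucc_ne_last] using Set.not_subset.1 h
  · simp [ubSet]

theorem ubSet_snoc_insert_of_subset {s : Set (Fin n)} (h : s ⊆ A) :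
    ubSet (snoc Q A) (insert (Fin.last n) (Fin.castSucc '' s)) = {Fin.last n} := by
  ext j
  induction j using Fin.lastCases
  · simpa [ubSet, Set.subset_def] using h
  · simp [ubSet, Fin.castSucc_ne_last]

theorem ubSet_snoc_insert_of_not_subset {s : Set (Fin n)} (h : ¬s ⊆ A) :
    ubSet (snoc Q A) (insert (Fin.last n) (Fin.castSucc '' s)) = ∅ := by
  ext j
  induction j using Fin.lastCases
  · simpa [ubSet] using Set.not_subset.1 h
  · simp [ubSet]

theorem isDown_snoc_iff {t : Set (Fin (n + 1))} :
    IsDown (snoc Q A) t ↔ ∃ s, IsDown Q s ∧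
      (t = Fin.castSucc '' s ∨ A ⊆ s ∧ t = insert (Fin.last n) (Fin.castSucc '' s)) := by
  constructor
  · intro ht
    refine ⟨Fin.castSucc ⁻¹' t, fun i j hij hj => ht _ _ (castSucc_castSucc_mem_snoc.2 hij) hj, ?_⟩
    by_cases hl : Fin.last n ∈ t
    · refine Or.inr ⟨fun i hi => ht _ _ (castSucc_last_mem_snoc.2 hi) hl, ?_⟩
      ext j
      induction j using Fin.lastCases <;> simp [hl, Fin.castSucc_ne_last]
    · refine Or.inl ?_
      ext j
      induction j using Fin.lastCases <;> simp [hl, Fin.castSucc_ne_last]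
  · rintro ⟨s, hs, rfl | ⟨hA, rfl⟩⟩ i j hij hj
    · induction i using Fin.lastCases <;> induction j using Fin.lastCases <;>
        simp [Fin.castSucc_ne_last] at hij hj ⊢
      exact hs _ _ hij hj
    · induction i using Fin.lastCases <;> induction j using Fin.lastCases <;>
        simp [Fin.castSucc_ne_last] at hij hj ⊢
      · exact hA hij
      · exact hs _ _ hij hj

/-- The order `Q` is naturally labelled and `L` lists its lower sets. -/
structure IsEnum (Q : Set (Fin n × Fin n)) (L : List (Set (Fin n))) : Prop where
  ord : IsOrd Q
  le : ∀ i j, (i, j) ∈ Q → i ≤ j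
  nodup : L.Nodup
  mem : ∀ s, s ∈ L ↔ IsDown Q s

open Classical in
/-- The lower sets of `snoc Q A`, given those of `Q`. -/
noncomputable def extList (A : Set (Fin n)) (L : List (Set (Fin n))) : List (Set (Fin (n + 1))) :=
  L.flatMap fun s => if A ⊆ s then
    [Fin.castSucc '' s, insert (Fin.last n) (Fin.castSucc '' s)] else [Fin.castSucc '' s]

theorem IsEnum.snoc {L : List (Set (Fin n))} (h : IsEnum Q L) (hA : IsDown Q A) :
    IsEnum (snoc Q A) (extList A L) where
  ord := h.ord.snoc hA
  le i j hij := by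
    induction i using Fin.lastCases <;> induction j using Fin.lastCases <;> simp at hij ⊢
    · exact Fin.le_last _
    · exact h.le _ _ hij
  nodup := by
    classical
    have hpre : ∀ s : Set (Fin n), Fin.castSucc ⁻¹' (insert (Fin.last n) (Fin.castSucc '' s)) = s :=
      fun s => by ext i; simp [Fin.castSucc_ne_last]
    have hpre' : ∀ s : Set (Fin n), Fin.castSucc ⁻¹' (Fin.castSucc '' s) = s :=
      fun s => Set.preimage_image_eq s (Fin.castSucc_injective n)
    rw [extList, List.nodup_flatMap]
    constructor
    · intro s _
      split_ifs
      · simp only [List.nodup_cons, List.mem_singleton, List.not_mem_nil, not_false_eq_true,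
          List.nodup_nil, and_true]
        exact fun h' => last_notMem_image s (h' ▸ Set.mem_insert _ _)
      · exact List.nodup_singleton _
    · refine h.nodup.imp fun {s t} hst u hs ht => hst ?_
      have key : ∀ r : Set (Fin n), u ∈ (if A ⊆ r then
          [Fin.castSucc '' r, insert (Fin.last n) (Fin.castSucc '' r)] else [Fin.castSucc '' r]) →
          r = Fin.castSucc ⁻¹' u := fun r hr => by
        split_ifs at hr <;> simp only [List.mem_cons, List.not_mem_nil, or_false] at hr
        · rcases hr with rfl | rfl
          · exact (hpre' r).symm
          · exact (hpre r).symm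
        · rw [hr, hpre']
      rw [key s (by convert hs), key t (by convert ht)]
  mem t := by
    rw [isDown_snoc_iff, extList, List.mem_flatMap]
    refine exists_congr fun s => and_congr (h.mem s) ?_
    split_ifs with hs <;> simp [hs]

theorem ext_downML (L : List (Set (Fin n))) :
    (downML Q L).ext (mask A) (2 ^ n) = downML (snoc Q A) (extList A L) := by
  classical
  induction L with
  | nil => rfl
  | cons s L ih =>
    have step : (downML Q (s :: L)).ext (mask A) (2 ^ n) =
      cond (Nat.beq (Nat.land (mask s) (mask A)) (mask s))
        (cond (Nat.beq (Nat.land (mask s) (mask A)) (mask A))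
          (ML.cons (mask s) (Nat.lor (mask (ubSet Q s)) (2 ^ n)) s.ncard
            (ML.cons (Nat.lor (mask s) (2 ^ n)) (2 ^ n) (Nat.succ s.ncard)
              ((downML Q L).ext (mask A) (2 ^ n))))
          (ML.cons (mask s) (Nat.lor (mask (ubSet Q s)) (2 ^ n)) s.ncard
            ((downML Q L).ext (mask A) (2 ^ n))))
        (cond (Nat.beq (Nat.land (mask s) (mask A)) (mask A))
          (ML.cons (mask s) (mask (ubSet Q s)) s.ncard
            (ML.cons (Nat.lor (mask s) (2 ^ n)) 0 (Nat.succ s.ncard)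
              ((downML Q L).ext (mask A) (2 ^ n))))
          (ML.cons (mask s) (mask (ubSet Q s)) s.ncard
            ((downML Q L).ext (mask A) (2 ^ n)))) := rfl
    have hone : ∀ l, downML (snoc Q A) (Fin.castSucc '' s :: l) =
        ML.cons (mask s) (mask (ubSet (snoc Q A) (Fin.castSucc '' s))) s.ncard
          (downML (snoc Q A) l) := fun l => by
      rw [← mask_castSucc s, ← ncard_castSucc s]; rfl
    have htwo : ∀ l, downML (snoc Q A) (insert (Fin.last n) (Fin.castSucc '' s) :: l) =
        ML.cons (Nat.lor (mask s) (2 ^ n))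
          (mask (ubSet (snoc Q A) (insert (Fin.last n) (Fin.castSucc '' s)))) (Nat.succ s.ncard)
          (downML (snoc Q A) l) := fun l => by
      rw [← mask_insert_last, ← ncard_castSucc s, Nat.succ_eq_add_one,
        ← Set.ncard_insert_of_notMem (last_notMem_image s)]
      rfl
    have hcons : extList A (s :: L) = (if A ⊆ s then
        [Fin.castSucc '' s, insert (Fin.last n) (Fin.castSucc '' s)] else [Fin.castSucc '' s]) ++
        extList A L := by
      rw [extList, List.flatMap_cons, extList]
    rw [step, ih, hcons]
    by_cases h1 : s ⊆ A <;> by_cases h2 : A ⊆ s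
    · rw [(beq_land_mask_left s A).2 h1, (beq_land_mask_right s A).2 h2, if_pos h2, List.cons_append,
        List.cons_append, hone, htwo, ubSet_snoc_of_subset h1, ubSet_snoc_insert_of_subset h1,
        mask_insert_last, mask_singleton_last]
      rfl
    · rw [(beq_land_mask_left s A).2 h1, Bool.eq_false_iff.2 (mt (beq_land_mask_right s A).1 h2),
        if_neg h2, List.cons_append, hone, ubSet_snoc_of_subset h1, mask_insert_last]
      rfl
    · rw [Bool.eq_false_iff.2 (mt (beq_land_mask_left s A).1 h1), (beq_land_mask_right s A).2 h2,
        if_pos h2, List.cons_append, List.cons_append, hone, htwo, ubSet_snoc_of_not_subset h1,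
        ubSet_snoc_insert_of_not_subset h1, mask_castSucc, mask_empty]
      rfl
    · rw [Bool.eq_false_iff.2 (mt (beq_land_mask_left s A).1 h1),
        Bool.eq_false_iff.2 (mt (beq_land_mask_right s A).1 h2), if_neg h2, List.cons_append, hone,
        ubSet_snoc_of_not_subset h1, mask_castSucc]
      rfl

theorem extT_upML (l : List (Fin n)) :
    (upML Q l).extT (mask A) (2 ^ n) A.ncard =
      upML (snoc Q A) (l.map Fin.castSucc ++ [Fin.last n]) := by
  induction l with
  | nil =>
    change ML.cons (2 ^ n) (2 ^ n) A.ncard ML.nil = ML.cons (2 ^ n) (mask _) (Set.ncard _) ML.nil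
    rw [upSet_snoc_last, mask_singleton_last, sdown_snoc_last, ncard_castSucc]
  | cons i l ih =>
    change ML.cons (2 ^ (i : ℕ)) (cond (Nat.beq (Nat.land (mask A) (2 ^ (i : ℕ))) 0)
      (mask (upSet Q i)) (Nat.lor (mask (upSet Q i)) (2 ^ n))) (sdown Q i).ncard
      ((upML Q l).extT (mask A) (2 ^ n) A.ncard) = ML.cons (2 ^ (i : ℕ))
        (mask (upSet (snoc Q A) (Fin.castSucc i))) (sdown (snoc Q A) (Fin.castSucc i)).ncard
        (upML (snoc Q A) (l.map Fin.castSucc ++ [Fin.last n]))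
    rw [ih, sdown_snoc_castSucc, ncard_castSucc, ← mask_singleton]
    congr 1
    by_cases h : i ∈ A
    · rw [upSet_snoc_castSucc_of_mem h, mask_insert_last,
        Bool.eq_false_iff.2 (mt (beq_land_mask_zero A {i}).1 _), cond_false]
      rw [← Ne, ← Set.nonempty_iff_ne_empty]
      exact ⟨i, h, rfl⟩
    · rw [upSet_snoc_castSucc_of_notMem h, mask_castSucc, (beq_land_mask_zero A {i}).2, cond_true]
      exact Set.inter_singleton_eq_empty.2 h

open Classical in
theorem cnt_upML (hQ : IsOrd Q) (t : ℕ) (l : List (Fin n)) (c : ℕ) :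
    (upML Q l).cnt (mask A) t c =
      if ∀ i ∈ l, IsMaxElt Q i → i ∉ A → t ≤ (sdown Q i).ncard then
        c + (l.filter fun i => IsMaxElt Q i ∧ i ∉ A ∧ (sdown Q i).ncard = t).length else 0 := by
  induction l generalizing c with
  | nil =>
    change c = _
    simp
  | cons i l ih =>
    have step : (upML Q (i :: l)).cnt (mask A) t c =
      cond (Nat.beq (mask (upSet Q i)) (2 ^ (i : ℕ)))
        (cond (Nat.beq (Nat.land (mask A) (2 ^ (i : ℕ))) 0)
          (cond (Nat.ble t (sdown Q i).ncard)
            (cond (Nat.beq (sdown Q i).ncard t) ((upML Q l).cnt (mask A) t (Nat.succ c))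
              ((upML Q l).cnt (mask A) t c)) 0) ((upML Q l).cnt (mask A) t c))
        ((upML Q l).cnt (mask A) t c) := rfl
    have hmax : Nat.beq (mask (upSet Q i)) (2 ^ (i : ℕ)) = true ↔ IsMaxElt Q i := by
      rw [← mask_singleton, beq_mask]
      exact ⟨fun h j hj => h.subset hj, fun h => Set.Subset.antisymm h fun j hj => by
        rw [Set.mem_singleton_iff.1 hj]; exact hQ.refl i⟩
    have hmem : Nat.beq (Nat.land (mask A) (2 ^ (i : ℕ))) 0 = true ↔ i ∉ A := by
      rw [← mask_singleton, beq_land_mask_zero, Set.inter_singleton_eq_empty]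
    rw [step, ih, ih]
    by_cases h1 : IsMaxElt Q i
    · by_cases h2 : i ∈ A
      · rw [hmax.2 h1, Bool.eq_false_iff.2 (mt hmem.1 (not_not.2 h2))]
        simp [h1, h2]
      · rw [hmax.2 h1, hmem.2 h2]
        by_cases h3 : t ≤ (sdown Q i).ncard
        · rw [Nat.ble_eq_true_of_le h3]
          by_cases h4 : (sdown Q i).ncard = t
          · rw [(iff_of_eq Nat.beq_eq).2 h4]
            simp [h1, h2, h4, add_assoc, add_comm]
          · rw [Bool.eq_false_iff.2 (mt (iff_of_eq Nat.beq_eq).1 h4)]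
            simp [h1, h2, h3, h4]
        · rw [Bool.eq_false_iff.2 (mt Nat.le_of_ble_eq_true h3)]
          simp [h1, h2, h3]
    · rw [Bool.eq_false_iff.2 (mt hmax.1 h1)]
      simp [h1]

theorem isMaxElt_castSucc_snoc {i : Fin n} :
    IsMaxElt (snoc Q A) (Fin.castSucc i) ↔ IsMaxElt Q i ∧ i ∉ A := by
  constructor
  · intro h
    refine ⟨fun j hj => Fin.castSucc_injective n (h _ (castSucc_castSucc_mem_snoc.2 hj)), fun hi => ?_⟩
    exact Fin.castSucc_ne_last i (h _ (castSucc_last_mem_snoc.2 hi)).symm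
  · rintro ⟨h1, h2⟩ j hj
    induction j using Fin.lastCases with
    | last => exact absurd (castSucc_last_mem_snoc.1 hj) h2
    | cast j => rw [h1 j (castSucc_castSucc_mem_snoc.1 hj)]

theorem cnt_eq_topCount (hQ : IsOrd Q) :
    (upML Q (List.finRange n)).cnt (mask A) A.ncard 1 = topCount Q A := by
  classical
  have hlast : Fin.last n ∈ tops (snoc Q A) ↔
      ∀ i ∈ List.finRange n, IsMaxElt Q i → i ∉ A → A.ncard ≤ (sdown Q i).ncard := by
    simp only [tops, Set.mem_ofPred_eq, isMaxElt_last_snoc, true_and, sdown_snoc_last,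
      ncard_castSucc, List.mem_finRange, forall_const]
    constructor
    · intro h i h1 h2
      have := h _ (isMaxElt_castSucc_snoc.2 ⟨h1, h2⟩)
      rwa [sdown_snoc_castSucc, ncard_castSucc] at this
    · intro h z hz
      induction z using Fin.lastCases with
      | last => rw [sdown_snoc_last, ncard_castSucc]
      | cast i =>
        rw [isMaxElt_castSucc_snoc] at hz
        rw [sdown_snoc_castSucc, ncard_castSucc]
        exact h i hz.1 hz.2
  rw [cnt_upML hQ, topCount]
  refine Eq.symm ?_
  by_cases h : Fin.last n ∈ tops (snoc Q A)
  · rw [if_pos h, if_pos (hlast.1 h)]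
    have htops : tops (snoc Q A) = insert (Fin.last n) (Fin.castSucc ''
        {i | i ∈ (List.finRange n).filter
          fun i => IsMaxElt Q i ∧ i ∉ A ∧ (sdown Q i).ncard = A.ncard}) := by
      ext z
      induction z using Fin.lastCases with
      | last => simp [h]
      | cast i =>
        simp only [Set.mem_insert_iff, Fin.castSucc_ne_last, false_or, castSucc_mem_image]
        simp only [List.mem_filter, List.mem_finRange, true_and, decide_eq_true_eq,
          Set.mem_ofPred_eq, tops, isMaxElt_castSucc_snoc, and_assoc]
        refine and_congr_right fun h1 => and_congr_right fun h2 => ?_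
        constructor
        · intro h3
          have h4 := h3 _ (isMaxElt_last_snoc Q A)
          have h5 := h.2 _ (isMaxElt_castSucc_snoc.2 ⟨h1, h2⟩)
          rw [sdown_snoc_castSucc, sdown_snoc_last, ncard_castSucc, ncard_castSucc] at h4 h5
          exact h4.antisymm h5
        · intro h3 z hz
          have h5 := h.2 z hz
          rwa [sdown_snoc_last, ncard_castSucc, ← h3, ← ncard_castSucc, ← sdown_snoc_castSucc] at h5
    rw [htops, Set.ncard_insert_of_notMem (last_notMem_image _), ncard_castSucc,
      ← List.toFinset_card_of_nodup ((List.nodup_finRange n).filter _), ← Set.ncard_coe_finset,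
      add_comm]
    simp
  · rw [if_neg h, if_neg (mt hlast.2 h)]

theorem dfs_eq_extSum {leaf : ML → ML → ℕ} {H : ∀ n, Set (Fin n × Fin n) → ℕ}
    (k n m : ℕ) (hm : n + k = m)
    (hleaf : ∀ (R : Set (Fin m × Fin m)) L, IsEnum R L →
      leaf (downML R L) (upML R (List.finRange m)) = H m R)
    {Q : Set (Fin n × Fin n)} {L : List (Set (Fin n))} (h : IsEnum Q L) (w : ℕ) :
    ML.dfs leaf k n (2 ^ n) (downML Q L) (upML Q (List.finRange n)) w = w * extSum H k n Q := by
  classical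
  induction k generalizing n w with
  | zero =>
    obtain rfl : n = m := hm
    exact congrArg (w * ·) (hleaf Q L h)
  | succ k ih =>
    have step : ∀ L' : List (Set (Fin n)), (∀ A ∈ L', IsDown Q A) →
        (ML.rec (motive := fun _ => ℕ) 0 (fun a _ s _ r =>
          cond (Nat.beq (ML.cnt a s (upML Q (List.finRange n)) 1) 0) r
            (Nat.add (ML.dfs leaf k (Nat.succ n) (Nat.mul 2 (2 ^ n)) ((downML Q L).ext a (2 ^ n))
              ((upML Q (List.finRange n)).extT a (2 ^ n) s)
              (Nat.mul (Nat.mul w (Nat.succ n))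
                (Nat.div 840 (ML.cnt a s (upML Q (List.finRange n)) 1)))) r))
          (downML Q L') : ℕ) =
        w * (L'.map fun A => (n + 1) * (840 / topCount Q A) * extSum H k (n + 1) (snoc Q A)).sum := by
      intro L' hL'
      induction L' with
      | nil => simp [downML, ML.mk]
      | cons A L' ih' =>
        have hA : IsDown Q A := hL' A List.mem_cons_self
        have h2 : Nat.mul 2 (2 ^ n) = 2 ^ (n + 1) := (pow_succ' 2 n).symm
        rw [List.map_cons, List.sum_cons, mul_add, ← ih' fun B hB => hL' B (List.mem_cons_of_mem _ hB)]
        change cond (Nat.beq (ML.cnt (mask A) A.ncard (upML Q (List.finRange n)) 1) 0) _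
            (Nat.add (ML.dfs leaf k (n + 1) (Nat.mul 2 (2 ^ n)) ((downML Q L).ext (mask A) (2 ^ n))
              ((upML Q (List.finRange n)).extT (mask A) (2 ^ n) A.ncard)
              (w * (n + 1) *
                (840 / (ML.cnt (mask A) A.ncard (upML Q (List.finRange n)) 1)))) _) = _
        rw [cnt_eq_topCount h.ord, h2, ext_downML, extT_upML, ← List.finRange_succ_last,
          ih (n + 1) (by omega) (h.snoc hA)]
        by_cases h0 : topCount Q A = 0
        · rw [h0]
          simp only [Nat.div_zero, mul_zero, zero_mul, zero_add]
          rfl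
        · rw [Bool.eq_false_iff.2 (mt (iff_of_eq Nat.beq_eq).1 h0), cond_false]
          refine congrArg₂ Nat.add ?_ rfl
          ring
    refine (step L fun A hA => (h.mem A).1 hA).trans ?_
    rw [extSum, ← List.sum_toFinset _ h.nodup]
    congr 1
    refine Finset.sum_congr ?_ fun _ _ => rfl
    ext A
    simp [h.mem]

end Enumeration

section Evaluation

open Equiv Pointwise

theorem ncard_strippedSets_smul {α : Type*} (σ : Perm α) (R : Set (α × α)) :
    (strippedSets (σ • R)).ncard = (strippedSets R).ncard := by
  have h : strippedSets (σ • R) = (fun u => σ • u) '' strippedSets R := by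
    ext u
    constructor
    · intro hu
      refine ⟨σ⁻¹ • u, ?_, smul_inv_smul σ u⟩
      have := smul_mem_strippedSets hu σ⁻¹
      rwa [inv_smul_smul] at this
    · rintro ⟨u, hu, rfl⟩
      exact smul_mem_strippedSets hu σ
  rw [h]
  exact Set.ncard_image_of_injective _ (MulAction.injective σ)

/-- The weighted sum of `leaf` over the orders on `k` points. -/
noncomputable def ML.run (leaf : ML → ML → ℕ) (k : ℕ) : ℕ :=
  ML.dfs leaf k 0 1 (ML.cons 0 0 0 ML.nil) ML.nil 1

open Classical in
theorem ML.run_eq {leaf : ML → ML → ℕ} {H : ∀ n, Set (Fin n × Fin n) → ℕ}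
    (hH : ∀ n (σ : Perm (Fin n)) R, H n (σ • R) = H n R) (m : ℕ) (hm : m ≤ 8)
    (hleaf : ∀ (R : Set (Fin m × Fin m)) L, IsEnum R L →
      leaf (downML R L) (upML R (List.finRange m)) = H m R) :
    ML.run leaf m = 840 ^ m * ∑ R with IsOrd R, H m R := by
  have hord : IsOrd (∅ : Set (Fin 0 × Fin 0)) :=
    ⟨fun i => i.elim0, fun i => i.elim0, fun i => i.elim0⟩
  have henum : IsEnum (∅ : Set (Fin 0 × Fin 0)) [∅] :=
    ⟨hord, fun i => i.elim0, List.nodup_singleton _, fun s => by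
      rw [List.mem_singleton]
      exact iff_of_true (Subsingleton.elim _ _) fun i => i.elim0⟩
  have hroot : downML (∅ : Set (Fin 0 × Fin 0)) [∅] = ML.cons 0 0 0 ML.nil := by
    have h0 : ∀ s : Set (Fin 0), mask s = 0 := fun s => by
      rw [Subsingleton.elim s ∅, mask_empty]
    change ML.cons (mask _) (mask _) (Set.ncard _) ML.nil = _
    rw [h0, h0, Set.ncard_empty]
  rw [← sum_extSum hH m 0 m (by omega) hm, Finset.sum_eq_single_of_mem ∅ (Finset.mem_filter.2 ⟨Finset.mem_univ _, hord⟩)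
    fun Q _ hQ => absurd (Subsingleton.elim Q ∅) hQ, ← one_mul (extSum H m 0 ∅),
    ← dfs_eq_extSum m 0 m (by omega) hleaf henum 1, hroot]
  rfl

theorem wordSqSum_eq {n v : ℕ} (hn : n ≤ 8) {p : ℕ → ℕ}
    (hp : ∀ m : ℕ, wordCount 8 n m = (p m : ℤ))
    (hv : ML.run (fun D T => p (D.mc T) ^ 2) n = 840 ^ n * v) : wordSqSum 8 n = v := by
  classical
  have h := ML.run_eq (leaf := fun D T => p (D.mc T) ^ 2)
    (H := fun _ R => p (strippedSets R).ncard ^ 2)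
    (fun _ σ R => by rw [ncard_strippedSets_smul]) n hn
    (fun R L h => by rw [mc_eq_ncard_strippedSets h.ord h.le h.mem])
  rw [hv] at h
  rw [Nat.eq_of_mul_eq_mul_left (by positivity) h, wordSqSum, ← Finset.sum_filter]
  push_cast
  simp only [hp]

theorem wordSqSum_eq_of_const {n v c : ℕ} (hn : n ≤ 8)
    (hp : ∀ m : ℕ, wordCount 8 n m = (c : ℤ))
    (hv : ML.run (fun _ _ => 1) n = 840 ^ n * v) : wordSqSum 8 n = v * c ^ 2 := by
  classical
  have h := ML.run_eq (leaf := fun _ _ => 1) (H := fun _ _ => 1)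
    (fun _ _ _ => rfl) n hn (fun _ _ _ => rfl)
  rw [hv] at h
  rw [Nat.eq_of_mul_eq_mul_left (by positivity) h, wordSqSum, ← Finset.sum_filter]
  simp only [hp, Finset.sum_const]
  simp

end Evaluation

section Values

theorem wordCount_eq (n e m : ℕ) : wordCount n e m =
    ∑ i ∈ Finset.range (e + 1), (e.choose i : ℤ) * ((-1) ^ i * ((e : ℤ) - i + m) ^ n) := by
  refine Finset.sum_congr rfl fun i hi => ?_
  have : i ≤ e + m := by
    have := Finset.mem_range.1 hi
    omega
  rw [nsmul_eq_mul, Nat.cast_sub this]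
  push_cast
  ring

set_option maxRecDepth 1000000

theorem wordSqSum_0 : wordSqSum 8 0 = 1 := by
  refine wordSqSum_eq (v := 1) (p := fun m => m ^ 8)
    (by decide) (fun m => ?_) (by decide +kernel)
  simp [wordCount_eq, Nat.choose]

theorem wordSqSum_1 : wordSqSum 8 1 = 65025 := by
  refine wordSqSum_eq (v := 65025) (p := fun m => 8 * m ^ 7 + 28 * m ^ 6 + 56 * m ^ 5 + 70 * m ^ 4 + 56 * m ^ 3 + 28 * m ^ 2 + 8 * m + 1)
    (by decide) (fun m => ?_) (by decide +kernel)
  simp [wordCount_eq, Finset.sum_range_succ, Nat.choose]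
  ring

theorem wordSqSum_2 : wordSqSum 8 2 = 2847333900 := by
  refine wordSqSum_eq (v := 2847333900) (p := fun m => 56 * m ^ 6 + 336 * m ^ 5 + 980 * m ^ 4 + 1680 * m ^ 3 + 1736 * m ^ 2 + 1008 * m + 254)
    (by decide) (fun m => ?_) (by decide +kernel)
  simp [wordCount_eq, Finset.sum_range_succ, Nat.choose]
  ring

theorem wordSqSum_3 : wordSqSum 8 3 = 605298981168 := by
  refine wordSqSum_eq (v := 605298981168) (p := fun m => 336 * m ^ 5 + 2520 * m ^ 4 + 8400 * m ^ 3 + 15120 * m ^ 2 + 14448 * m + 5796)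
    (by decide) (fun m => ?_) (by decide +kernel)
  simp [wordCount_eq, Finset.sum_range_succ, Nat.choose]
  ring

theorem wordSqSum_4 : wordSqSum 8 4 = 52727863737024 := by
  refine wordSqSum_eq (v := 52727863737024) (p := fun m => 1680 * m ^ 4 + 13440 * m ^ 3 + 43680 * m ^ 2 + 67200 * m + 40824)
    (by decide) (fun m => ?_) (by decide +kernel)
  simp [wordCount_eq, Finset.sum_range_succ, Nat.choose]
  ring

theorem wordSqSum_5 : wordSqSum 8 5 = 2216224343289600 := by
  refine wordSqSum_eq (v := 2216224343289600) (p := fun m => 6720 * m ^ 3 + 50400 * m ^ 2 + 134400 * m + 126000)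
    (by decide) (fun m => ?_) (by decide +kernel)
  simp [wordCount_eq, Finset.sum_range_succ, Nat.choose]
  ring

theorem wordSqSum_6 : wordSqSum 8 6 = 45350941949107200 := by
  refine wordSqSum_eq (v := 45350941949107200) (p := fun m => 20160 * m ^ 2 + 120960 * m + 191520)
    (by decide) (fun m => ?_) (by decide +kernel)
  simp [wordCount_eq, Finset.sum_range_succ, Nat.choose]
  ring

theorem wordSqSum_7 : wordSqSum 8 7 = 372854550781440000 := by
  refine wordSqSum_eq (v := 372854550781440000) (p := fun m => 40320 * m + 141120)
    (by decide) (fun m => ?_) (by decide +kernel)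
  simp [wordCount_eq, Finset.sum_range_succ, Nat.choose]
  ring

theorem wordSqSum_8 : wordSqSum 8 8 = 431723379 * 40320 ^ 2 := by
  refine wordSqSum_eq_of_const (v := 431723379) (c := 40320) le_rfl (fun m => ?_)
    (by decide +kernel)
  simp [wordCount_eq, Finset.sum_range_succ, Nat.choose]
  ring

end Values

/-- For a field `k` of characteristic zero and a set `X` with 8 elements, the Jacobson
radical `J(𝓡_X)` of the algebra of relations `𝓡_X = k𝓒(X,X)` has dimension 18446568932288588616
as a `k`-vector space. -/
theorem relAlgebra_jacobson_dim (k : Type) [Field k] [CharZero k]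
    (X : Type) [Fintype X] (hX : Fintype.card X = 8) :
    Module.finrank k
      (Submodule.restrictScalars k
        (Ideal.jacobson (⊥ : Ideal (MonoidAlgebra k (Set (X × X)))))) = 18446568932288588616 := by
  have h := finrank_jacobson_add_sum (k := k) (X := X)
  rw [Nat.card_eq_fintype_card, hX] at h
  simp only [Finset.sum_range_succ, Finset.sum_range_zero, wordSqSum_0, wordSqSum_1, wordSqSum_2,
    wordSqSum_3, wordSqSum_4, wordSqSum_5, wordSqSum_6, wordSqSum_7, wordSqSum_8] at h
  norm_num [Nat.factorial] at h
  omega
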